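/- Assume the generalized Riemann hypothesis for L(s,χ), where χ is a primitive Dirichlet character modulo q > 1. Let t ≥ 2 and let x satisfy 4 ≤ x ≤ t². Then for all σ ≥ σ₁ = 1/2 + 1/log x, (L'/L)(σ+it,χ) = -∑_{n<x²} Λ_x(n)χ(n) n^{-(σ+it)} - [x^{1/2-σ}(1+x^{1/2-σ})ω / (1 - (1/e)(1+1/e)ω')] · Re(∑_{n<x²} Λ_x(n)χ(n) n^{-(σ₁+it)}) + [x^{1/2-σ}(1+x^{1/2-σ})ω / (1 - (1/e)(1+1/e)ω')] · (1/2)log(q(t+1)) + O(x^{1/2-σ}), where ω (depending on σ, t, x, χ) is a complex number with |ω| ≤ 1 and ω' (depending on t, x, χ) is a real number with -1 ≤ ω' ≤ 1, and the implied constant is absolute. -/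

import Mathlib

open Complex Real ArithmeticFunction

/-- The generalized Riemann hypothesis for the Dirichlet L-function of `χ`. -/
def GRH {q : ℕ} [NeZero q] (χ : DirichletCharacter ℂ q) : Prop :=
  ∀ ρ : ℂ, DirichletCharacter.LFunction χ ρ = 0 → 0 < ρ.re → ρ.re < 1 → ρ.re = 1 / 2

/-- Selberg's truncated von Mangoldt function `Λ_x`. -/
noncomputable def Lambdax (x : ℝ) (n : ℕ) : ℝ :=
  if (n : ℝ) ≤ x then vonMangoldt n
  else if (n : ℝ) ≤ x ^ 2 then vonMangoldt n * (Real.log (x ^ 2 / n) / Real.log x)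
  else 0

/-- The Dirichlet polynomial `∑_{n<x²} Λ_x(n) χ(n) n^{-s}`. -/
noncomputable def Dpoly {q : ℕ} (χ : DirichletCharacter ℂ q) (x : ℝ) (s : ℂ) : ℂ :=
  ∑ n ∈ Finset.filter (fun n : ℕ => (n : ℝ) < x ^ 2) (Finset.range (⌈x ^ 2⌉₊ + 1)),
    (Lambdax x n : ℂ) * χ n / (n : ℂ) ^ s

section

open Filter Topology

lemma norm_GammaSeq_le {s : ℂ} (hs : 0 < s.re) {n : ℕ} (hn : n ≠ 0) :
    ‖GammaSeq s n‖ ≤ Real.Gamma s.re := by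
  rw [GammaSeq_eq_approx_Gamma_integral hs hn, Real.Gamma_eq_integral hs]
  have hint : MeasureTheory.IntegrableOn (fun x : ℝ => Real.exp (-x) * x ^ (s.re - 1)) (Set.Ioi 0) :=
    Real.GammaIntegral_convergent hs
  refine (intervalIntegral.norm_integral_le_of_norm_le (by positivity)
    (g := fun x : ℝ => Real.exp (-x) * x ^ (s.re - 1)) ?_ ?_).trans ?_
  · filter_upwards with x hx
    have hx0 : 0 < x := hx.1
    rw [norm_mul, norm_cpow_eq_rpow_re_of_pos hx0, sub_re, one_re]
    gcongr
    rw [Complex.norm_real, Real.norm_eq_abs, abs_of_nonneg]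
    · have := Real.one_sub_div_pow_le_exp_neg hx.2
      exact this
    · apply pow_nonneg
      have : x / n ≤ 1 := by
        rw [div_le_one (by positivity)]; exact hx.2
      linarith
  · rw [intervalIntegrable_iff_integrableOn_Ioc_of_le (by positivity)]
    exact hint.mono_set Set.Ioc_subset_Ioi_self
  · rw [intervalIntegral.integral_of_le (by positivity)]
    apply MeasureTheory.setIntegral_mono_set hint
    · filter_upwards [MeasureTheory.ae_restrict_mem measurableSet_Ioi] with x hx
      have : (0 : ℝ) < x := hx
      positivity
    · exact Set.Ioc_subset_Ioi_self.eventuallyLE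


lemma tendsto_deriv_of_tendsto_of_bounded {U : Set ℂ} (hU : IsOpen U) {f : ℕ → ℂ → ℂ} {g : ℂ → ℂ}
    {z : ℂ} {r M : ℝ} (hr : 0 < r) (hzr : Metric.closedBall z r ⊆ U)
    (hf : ∀ᶠ n in atTop, DifferentiableOn ℂ (f n) U) (hg : DifferentiableOn ℂ g U)
    (hlim : ∀ w ∈ U, Tendsto (fun n => f n w) atTop (𝓝 (g w)))
    (hM : ∀ᶠ n in atTop, ∀ w ∈ Metric.closedBall z r, ‖f n w‖ ≤ M) :
    Tendsto (fun n => deriv (f n) z) atTop (𝓝 (deriv g z)) := by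
  have key : Tendsto (fun n => cderiv r (f n) z) atTop (𝓝 (cderiv r g z)) := by
    unfold cderiv
    apply Tendsto.const_smul
    unfold circleIntegral
    have hmem : ∀ θ : ℝ, circleMap z r θ ∈ Metric.closedBall z r := fun θ =>
      circleMap_mem_closedBall z hr.le θ
    have hne : ∀ θ : ℝ, circleMap z r θ - z ≠ 0 := fun θ =>
      sub_ne_zero.mpr (circleMap_ne_center hr.ne')
    have hnorm : ∀ θ : ℝ, ‖circleMap z r θ - z‖ = r := fun θ => by
      simp [circleMap, abs_of_pos hr]
    refine intervalIntegral.tendsto_integral_filter_of_dominated_convergence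
      (fun _ => r * ((r ^ 2)⁻¹ * M)) ?_ ?_ ?_ ?_
    · filter_upwards [hf] with n hn
      have hc : Continuous fun θ => f n (circleMap z r θ) :=
        (hn.continuousOn.comp_continuous (continuous_circleMap z r) fun θ => hzr (hmem θ))
      have : Continuous fun θ : ℝ => deriv (circleMap z r) θ •
          ((circleMap z r θ - z) ^ (-2 : ℤ)) • f n (circleMap z r θ) := by
        simp only [deriv_circleMap]
        have h1 : Continuous fun θ : ℝ => (circleMap z r θ - z) ^ (-2 : ℤ) :=
          Continuous.zpow₀ ((continuous_circleMap z r).sub continuous_const) _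
            fun θ => Or.inl (hne θ)
        exact ((continuous_circleMap 0 r).mul continuous_const).smul (h1.smul hc)
      exact this.aestronglyMeasurable
    · filter_upwards [hM] with n hn
      filter_upwards with θ _
      rw [norm_smul, norm_smul, deriv_circleMap]
      have h1 := hn _ (hmem θ)
      simp [circleMap, abs_of_pos hr] at h1 ⊢
      gcongr
    · exact intervalIntegrable_const
    · filter_upwards with θ _
      exact (Tendsto.const_smul (hlim _ (hzr (hmem θ))) _).const_smul _
  rw [← cderiv_eq_deriv hU hg hr hzr]
  refine key.congr' ?_
  filter_upwards [hf] with n hn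
  exact cderiv_eq_deriv hU hn hr hzr

lemma tendsto_digamma {z : ℂ} (hz : 0 < z.re) :
    Tendsto (fun n : ℕ => (Real.log n : ℂ) - ∑ k ∈ Finset.range (n + 1), (z + k)⁻¹) atTop
      (𝓝 (digamma z)) := by
  have hU : IsOpen {w : ℂ | 0 < w.re} := isOpen_lt continuous_const continuous_re
  have hne : ∀ w : ℂ, 0 < w.re → ∀ k : ℕ, w + k ≠ 0 := fun w hw k h => by
    have := congrArg re h
    simp at this
    have hk : (0 : ℝ) ≤ k := by positivity
    linarith
  have hball : Metric.closedBall z (z.re / 2) ⊆ {w : ℂ | 0 < w.re} := fun w hw => by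
    have h1 := (abs_re_le_norm (w - z)).trans (mem_closedBall_iff_norm.mp hw)
    have h2 := (abs_le.mp h1).1
    simp at h2
    show 0 < w.re
    linarith
  have hdG : DifferentiableOn ℂ Complex.Gamma {w : ℂ | 0 < w.re} := fun w hw =>
    (differentiableAt_Gamma w fun m h => by
      have : w.re = -(m : ℝ) := by rw [h]; simp
      have hk : (0 : ℝ) ≤ m := by positivity
      have hw' : 0 < w.re := hw
      linarith).differentiableWithinAt
  have hdS : ∀ n : ℕ, n ≠ 0 → ∀ w : ℂ, 0 < w.re →
      HasDerivAt (fun w => Complex.GammaSeq w n) (GammaSeq w n *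
        ((Real.log n : ℂ) - ∑ k ∈ Finset.range (n + 1), (w + k)⁻¹)) w := by
    intro n hn w hw
    have hn' : (n : ℂ) ≠ 0 := by exact_mod_cast hn
    have hP0 : ∏ j ∈ Finset.range (n + 1), (w + j) ≠ 0 :=
      Finset.prod_ne_zero_iff.mpr fun k _ => hne w hw k
    have hP : DifferentiableAt ℂ (fun w : ℂ => ∏ j ∈ Finset.range (n + 1), (w + j)) w := by
      fun_prop
    have hN : HasDerivAt (fun w : ℂ => (n : ℂ) ^ w * (n.factorial : ℂ))
        ((n : ℂ) ^ w * Complex.log n * (n.factorial : ℂ)) w := by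
      have := ((hasDerivAt_id w).const_cpow (c := (n : ℂ)) (Or.inl hn')).mul_const
        (n.factorial : ℂ)
      simpa using this
    have hlog : logDeriv (fun w : ℂ => ∏ j ∈ Finset.range (n + 1), (w + j)) w
        = ∑ k ∈ Finset.range (n + 1), (w + k)⁻¹ := by
      rw [logDeriv_prod]
      · refine Finset.sum_congr rfl fun k _ => ?_
        simp [logDeriv_apply]
      · exact fun k _ => hne w hw k
      · intro k _; fun_prop
    have := hN.div hP.hasDerivAt hP0
    refine this.congr_deriv ?_
    rw [← hlog, logDeriv_apply, Complex.GammaSeq, ← natCast_log]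
    field_simp
  have hne0 : Gamma z ≠ 0 := Gamma_ne_zero_of_re_pos hz
  obtain ⟨M, hM⟩ : ∃ M, ∀ w ∈ Metric.closedBall z (z.re / 2), Real.Gamma w.re ≤ M := by
    have hc : ContinuousOn (fun w : ℂ => Real.Gamma w.re) (Metric.closedBall z (z.re / 2)) :=
      fun w hw => by
        have hw0 : 0 < w.re := hball hw
        have h1 : ContinuousAt Real.Gamma w.re :=
          (Real.differentiableAt_Gamma fun m h => by
            have hk : (0 : ℝ) ≤ m := by positivity
            linarith).continuousAt
        exact (ContinuousAt.comp (g := Real.Gamma) h1 continuous_re.continuousAt).continuousWithinAt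
    obtain ⟨M, hM⟩ := (isCompact_closedBall z (z.re / 2)).bddAbove_image hc
    exact ⟨M, fun w hw => hM ⟨w, hw, rfl⟩⟩
  have h1 : Tendsto (fun n => deriv (fun w => Complex.GammaSeq w n) z) atTop (𝓝 (deriv Gamma z)) := by
    refine tendsto_deriv_of_tendsto_of_bounded hU (half_pos hz) hball (M := M) ?_ hdG ?_ ?_
    · filter_upwards [eventually_ne_atTop 0] with n hn w hw
      exact (hdS n hn w hw).differentiableAt.differentiableWithinAt
    · intro w _
      exact GammaSeq_tendsto_Gamma w
    · filter_upwards [eventually_ne_atTop 0] with n hn w hw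
      exact (norm_GammaSeq_le (hball hw) hn).trans (hM w hw)
  have h2 := h1.div (GammaSeq_tendsto_Gamma z) hne0
  rw [digamma_def, logDeriv_apply]
  refine h2.congr' ?_
  filter_upwards [eventually_ne_atTop 0, (GammaSeq_tendsto_Gamma z).eventually_ne hne0]
    with n hn hn'
  rw [Pi.div_apply, (hdS n hn z hz).deriv]
  field_simp

lemma norm_digamma_sub_le_sqrt : ∃ C : ℝ, 0 < C ∧ ∀ z w : ℂ, 1 / 4 ≤ z.re → 1 / 4 ≤ w.re →
    ‖digamma z - digamma w‖ ≤ C * √‖z - w‖ := by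
  have hs : Summable fun k : ℕ => 1 / |(k : ℝ) + 1 / 4| ^ (3 / 2 : ℝ) :=
    (Real.summable_one_div_nat_add_rpow (1 / 4) (3 / 2)).mpr (by norm_num)
  refine ⟨2 * (∑' k : ℕ, 1 / |(k : ℝ) + 1 / 4| ^ (3 / 2 : ℝ)) + 1, ?_, fun z w hz hw => ?_⟩
  · have : 0 ≤ ∑' k : ℕ, 1 / |(k : ℝ) + 1 / 4| ^ (3 / 2 : ℝ) := tsum_nonneg fun k => by positivity
    linarith
  have hlim := (tendsto_digamma (z := z) (by linarith)).sub (tendsto_digamma (z := w) (by linarith))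
  refine le_of_tendsto hlim.norm (Eventually.of_forall fun n => ?_)
  have hterm : ∀ k : ℕ, ‖(w + k)⁻¹ - (z + k)⁻¹‖ ≤
      2 * √‖z - w‖ * (1 / |(k : ℝ) + 1 / 4| ^ (3 / 2 : ℝ)) := by
    intro k
    have hm : (0 : ℝ) < (k : ℝ) + 1 / 4 := by positivity
    have hA : (k : ℝ) + 1 / 4 ≤ ‖z + k‖ := by
      refine le_trans ?_ (re_le_norm _)
      simp; linarith
    have hB : (k : ℝ) + 1 / 4 ≤ ‖w + k‖ := by
      refine le_trans ?_ (re_le_norm _)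
      simp; linarith
    have hz0 : z + k ≠ 0 := norm_pos_iff.mp (hm.trans_le hA)
    have hw0 : w + k ≠ 0 := norm_pos_iff.mp (hm.trans_le hB)
    have hD : ‖z - w‖ ≤ ‖z + k‖ + ‖w + k‖ := by
      have := norm_sub_le (z + k) (w + k)
      simpa using this
    have hD' : √‖z - w‖ ≤ √‖z + k‖ + √‖w + k‖ :=
      (Real.sqrt_le_sqrt hD).trans <| Real.sqrt_le_iff.mpr ⟨by positivity, by
        rw [add_sq, Real.sq_sqrt (norm_nonneg _), Real.sq_sqrt (norm_nonneg _)]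
        have : 0 ≤ 2 * √‖z + k‖ * √‖w + k‖ := by positivity
        linarith⟩
    have h1 : (w + k)⁻¹ - (z + k)⁻¹ = (z - w) / ((w + k) * (z + k)) := by
      field_simp; ring
    rw [h1, norm_div, norm_mul, abs_of_pos hm]
    have hc : ((k : ℝ) + 1 / 4) ^ (3 / 2 : ℝ) = √((k : ℝ) + 1 / 4) ^ 3 := by
      rw [Real.sqrt_eq_rpow, ← Real.rpow_natCast, ← Real.rpow_mul hm.le]
      norm_num
    rw [hc]
    have ha := Real.sqrt_le_sqrt hA
    have hb := Real.sqrt_le_sqrt hB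
    have hc0 := Real.sqrt_pos.mpr hm
    have hd0 := Real.sqrt_nonneg ‖z - w‖
    rw [← Real.mul_self_sqrt (norm_nonneg (z - w)), ← Real.mul_self_sqrt (norm_nonneg (z + k)),
      ← Real.mul_self_sqrt (norm_nonneg (w + k))]
    rw [Real.sqrt_mul_self (Real.sqrt_nonneg _)]
    generalize √‖z - w‖ = d at *
    generalize √‖z + k‖ = a at *
    generalize √‖w + k‖ = b at *
    generalize √((k : ℝ) + 1 / 4) = c at *
    have ha0 := hc0.trans_le ha
    have hb0 := hc0.trans_le hb
    rw [mul_one_div, div_le_div_iff₀ (by positivity) (by positivity)]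
    have e1 : c ^ 3 ≤ a * b ^ 2 := by
      calc c ^ 3 = c * c ^ 2 := by ring
        _ ≤ a * b ^ 2 := by gcongr
    have e2 : c ^ 3 ≤ b * a ^ 2 := by
      calc c ^ 3 = c * c ^ 2 := by ring
        _ ≤ b * a ^ 2 := by gcongr
    have e3 : d * c ^ 3 ≤ 2 * (b * b * (a * a)) := by
      calc d * c ^ 3 ≤ (a + b) * c ^ 3 := by gcongr
        _ = a * c ^ 3 + b * c ^ 3 := by ring
        _ ≤ a * (a * b ^ 2) + b * (b * a ^ 2) := by gcongr
        _ = _ := by ring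
    calc d * d * c ^ 3 = d * (d * c ^ 3) := by ring
      _ ≤ d * (2 * (b * b * (a * a))) := by gcongr
      _ = _ := by ring
  have : ((Real.log n : ℂ) - ∑ k ∈ Finset.range (n + 1), (z + k)⁻¹) -
      ((Real.log n : ℂ) - ∑ k ∈ Finset.range (n + 1), (w + k)⁻¹) =
      ∑ k ∈ Finset.range (n + 1), ((w + k)⁻¹ - (z + k)⁻¹) := by
    rw [Finset.sum_sub_distrib]; ring
  rw [this]
  calc _ ≤ ∑ k ∈ Finset.range (n + 1), 2 * √‖z - w‖ * (1 / |(k : ℝ) + 1 / 4| ^ (3 / 2 : ℝ)) :=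
        norm_sum_le_of_le _ fun k _ => hterm k
    _ = 2 * √‖z - w‖ * ∑ k ∈ Finset.range (n + 1), (1 / |(k : ℝ) + 1 / 4| ^ (3 / 2 : ℝ)) := by
        rw [Finset.mul_sum]
    _ ≤ 2 * √‖z - w‖ * ∑' k : ℕ, (1 / |(k : ℝ) + 1 / 4| ^ (3 / 2 : ℝ)) := by
        gcongr
        exact hs.sum_le_tsum _ fun k _ => by positivity
    _ ≤ _ := by
        have := Real.sqrt_nonneg ‖z - w‖
        nlinarith

lemma abs_re_digamma_sub_log_le : ∃ C : ℝ, 0 < C ∧ ∀ (t : ℝ) (z : ℂ), 2 ≤ t → 0 < z.re →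
    z.re ≤ 3 / 2 → z.im = t / 2 → |(digamma z).re - Real.log (t + 1)| ≤ C := by
  refine ⟨100, by norm_num, fun t z ht hz0 hz1 hz2 => ?_⟩
  obtain ⟨N, hN⟩ : ∃ N : ℕ, N = ⌈t⌉₊ := ⟨_, rfl⟩
  have hN1 : t ≤ N := hN ▸ Nat.le_ceil t
  have hN2 : (N : ℝ) < t + 1 := hN ▸ Nat.ceil_lt_add_one (by linarith)
  have hN0 : (2 : ℝ) ≤ N := ht.trans hN1
  obtain ⟨m, rfl⟩ : ∃ m : ℕ, N = m + 1 := Nat.exists_eq_add_of_lt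
    (show 0 < N by have : (0 : ℝ) < N := by linarith
                   exact_mod_cast this) |>.imp fun m hm => by simpa using hm
  have hNre : ((m + 1 : ℕ) : ℂ).re = ((m + 1 : ℕ) : ℝ) := by simp
  have hlim := (tendsto_digamma hz0).sub (tendsto_digamma (z := ((m + 1 : ℕ) : ℂ))
    (by rw [hNre]; linarith))
  have h1 : ‖digamma z - digamma ((m + 1 : ℕ) : ℂ)‖ ≤ 96 := by
    refine le_of_tendsto hlim.norm (Eventually.of_forall fun n => ?_)
    set M : ℝ := ((m + 1 : ℕ) : ℝ) with hM
    have hterm : ∀ k : ℕ, ‖(((m + 1 : ℕ) : ℂ) + k)⁻¹ - (z + k)⁻¹‖ ≤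
        48 * M * (1 / (M + k - 1) - 1 / (M + (k + 1 : ℕ) - 1)) := by
      intro k
      have hk : (0 : ℝ) ≤ k := by positivity
      have hA : (M + k) / 8 ≤ ‖z + k‖ := by
        have e1 := re_le_norm (z + k)
        have e2 := im_le_norm (z + k)
        simp at e1 e2
        linarith
      have hB : ‖((m + 1 : ℕ) : ℂ) + k‖ = M + k := by
        rw [hM, ← Nat.cast_add, ← Nat.cast_add, Complex.norm_natCast]
      have hD : ‖z - ((m + 1 : ℕ) : ℂ)‖ ≤ 3 * M := by
        refine (norm_sub_le _ _).trans ?_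
        rw [Complex.norm_natCast, ← hM]
        have := norm_le_abs_re_add_abs_im z
        rw [abs_of_pos hz0, hz2, abs_of_pos (by linarith)] at this
        linarith
      have hz0 : z + k ≠ 0 := norm_pos_iff.mp (lt_of_lt_of_le (by linarith) hA)
      have hw0 : ((m + 1 : ℕ) : ℂ) + k ≠ 0 := norm_pos_iff.mp (by rw [hB]; linarith)
      have e : (((m + 1 : ℕ) : ℂ) + k)⁻¹ - (z + k)⁻¹
          = (z - ((m + 1 : ℕ) : ℂ)) / ((((m + 1 : ℕ) : ℂ) + k) * (z + k)) := by
        field_simp; ring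
      rw [e, norm_div, norm_mul, hB]
      calc _ ≤ 3 * M / ((M + k) * ((M + k) / 8)) := by
            gcongr
        _ = 24 * M * (1 / (M + k) ^ 2) := by
            field_simp; ring
        _ ≤ 24 * M * (2 * (1 / (M + k - 1) - 1 / (M + (k + 1 : ℕ) - 1))) := by
            gcongr
            push_cast
            have : 0 < M + k - 1 := by linarith
            rw [div_sub_div _ _ (by linarith) (by linarith), mul_div_assoc',
              div_le_div_iff₀ (by nlinarith) (by nlinarith)]
            nlinarith
        _ = _ := by ring
    have : ((Real.log n : ℂ) - ∑ k ∈ Finset.range (n + 1), (z + k)⁻¹) -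
        ((Real.log n : ℂ) - ∑ k ∈ Finset.range (n + 1), (((m + 1 : ℕ) : ℂ) + k)⁻¹) =
        ∑ k ∈ Finset.range (n + 1), ((((m + 1 : ℕ) : ℂ) + k)⁻¹ - (z + k)⁻¹) := by
      rw [Finset.sum_sub_distrib]; ring
    rw [this]
    refine (norm_sum_le_of_le _ fun k _ => hterm k).trans ?_
    rw [← Finset.mul_sum, Finset.sum_range_sub' (fun k : ℕ => 1 / (M + k - 1))]
    have e1 : 0 ≤ 1 / (M + (n + 1 : ℕ) - 1) := by
      apply one_div_nonneg.mpr
      push_cast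
      have : (0 : ℝ) ≤ n := by positivity
      linarith
    have e2 : M * (1 / (M + (0 : ℕ) - 1)) ≤ 2 := by
      rw [mul_one_div, div_le_iff₀ (by simp; linarith)]
      simp; linarith
    nlinarith
  have h2 : digamma ((m + 1 : ℕ) : ℂ) = ((-Real.eulerMascheroniConstant + (harmonic m : ℝ) : ℝ) : ℂ) := by
    rw [digamma_def, logDeriv_apply, Nat.cast_succ, Complex.deriv_Gamma_nat, Complex.Gamma_nat_eq_factorial]
    have : (m.factorial : ℂ) ≠ 0 := by exact_mod_cast m.factorial_ne_zero
    field_simp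
    push_cast
    rfl
  have h3 := (abs_re_le_norm _).trans h1
  rw [h2, sub_re, ofReal_re] at h3
  have h4 := log_add_one_le_harmonic m
  have h5 := harmonic_le_one_add_log m
  have h6 := Real.one_half_lt_eulerMascheroniConstant
  have h7 := Real.eulerMascheroniConstant_lt_two_thirds
  have hm : (1 : ℝ) ≤ m := by push_cast at hN0; linarith
  push_cast at hN1 hN2 h4
  have h8 : Real.log m ≤ Real.log (t + 1) := Real.log_le_log (by linarith) (by linarith)
  have h9 : Real.log (t + 1) ≤ Real.log (m + 1) + 1 := by
    have : Real.log (t + 1) ≤ Real.log (2 * (m + 1)) := Real.log_le_log (by linarith) (by linarith)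
    rw [Real.log_mul (by norm_num) (by linarith)] at this
    have := Real.log_two_lt_d9
    linarith
  rw [abs_le] at h3 ⊢
  constructor <;> linarith [h3.1, h3.2]

namespace DirichletCharacter

variable {q : ℕ} [NeZero q]

lemma sum_range_natCast_eq_zero {χ : DirichletCharacter ℂ q} (hχ : χ ≠ 1) (n : ℕ) :
    ∑ k ∈ Finset.range q, χ ((n + k : ℕ) : ZMod q) = 0 := by
  rw [← MulChar.sum_eq_zero_of_ne_one hχ, ← Equiv.sum_comp (Equiv.addLeft (n : ZMod q)) χ]
  refine Finset.sum_nbij' (fun k : ℕ => (k : ZMod q)) ZMod.val ?_ ?_ ?_ ?_ ?_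
  · simp
  · intro a _
    simpa using ZMod.val_lt a
  · intro k hk
    exact ZMod.val_cast_of_lt (by simpa using hk)
  · intro a _
    simp
  · intro k _
    simp

lemma norm_sum_range_natCast_le {χ : DirichletCharacter ℂ q} (hχ : χ ≠ 1) (n : ℕ) :
    ‖∑ k ∈ Finset.range n, χ (k : ZMod q)‖ ≤ q := by
  induction n using Nat.strong_induction_on with
  | _ n ih =>
    rcases lt_or_ge n q with h | h
    · calc _ ≤ ∑ k ∈ Finset.range n, (1 : ℝ) := norm_sum_le_of_le _ fun k _ => χ.norm_le_one _
        _ ≤ q := by simpa using h.le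
    · obtain ⟨m, rfl⟩ := Nat.exists_eq_add_of_le' h
      rw [Finset.sum_range_add, sum_range_natCast_eq_zero hχ, add_zero]
      exact ih m (by have := NeZero.pos q; omega)

lemma norm_sum_Icc_natCast_le {χ : DirichletCharacter ℂ q} (hχ : χ ≠ 1) (n : ℕ) :
    ‖∑ k ∈ Finset.Icc 1 n, χ (k : ZMod q)‖ ≤ 2 * q := by
  have h1 : ∑ k ∈ Finset.Icc 1 n, χ (k : ZMod q) =
      ∑ k ∈ Finset.range (n + 1), χ (k : ZMod q) - ∑ k ∈ Finset.range 1, χ (k : ZMod q) := by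
    rw [← Finset.sum_Ico_eq_sub _ (by omega)]
    rfl
  rw [h1, two_mul]
  exact (norm_sub_le _ _).trans (add_le_add (norm_sum_range_natCast_le hχ _)
    (norm_sum_range_natCast_le hχ _))

lemma LFunction_eq_mul_integral {χ : DirichletCharacter ℂ q} (hχ : χ ≠ 1) {s : ℂ}
    (hs : 0 < s.re) : LFunction χ s =
      s * ∫ t in Set.Ioi (1 : ℝ), (∑ k ∈ Finset.Icc 1 ⌊t⌋₊, χ (k : ZMod q)) *
        (t : ℂ) ^ (-(s + 1)) := by
  set B : ℝ → ℂ := fun t : ℝ => ∑ k ∈ Finset.Icc 1 ⌊t⌋₊, χ (k : ZMod q) with hB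
  have hB1 : ∀ t < 1, B t = 0 := fun t ht => by
    simp [hB, Nat.floor_eq_zero.mpr ht]
  have hBb : ∀ t, ‖B t‖ ≤ 2 * q := fun t => norm_sum_Icc_natCast_le hχ _
  have hmeas : Measurable B :=
    (measurable_from_nat (f := fun n : ℕ => ∑ k ∈ Finset.Icc 1 n, χ (k : ZMod q))).comp
      Nat.measurable_floor
  have hmel : ∀ w : ℂ, mellin B (-w) = ∫ t in Set.Ioi (1 : ℝ), B t * (t : ℂ) ^ (-(w + 1)) := by
    intro w
    rw [mellin, MeasureTheory.setIntegral_eq_of_subset_of_ae_sdiff_eq_zero (s := Set.Ioi 1)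
      measurableSet_Ioi.nullMeasurableSet (Set.Ioi_subset_Ioi zero_le_one)]
    · refine MeasureTheory.setIntegral_congr_fun measurableSet_Ioi fun t _ => ?_
      simp only [smul_eq_mul]
      rw [mul_comm, show -w - 1 = -(w + 1) by ring]
    · have : ∀ᵐ t : ℝ, t ≠ 1 := by simp [MeasureTheory.ae_iff]
      filter_upwards [this] with t ht1 ht
      have : t < 1 := lt_of_le_of_ne (not_lt.mp ht.2) ht1
      rw [hB1 t this, smul_zero]
  have hU : IsOpen {w : ℂ | 0 < w.re} := isOpen_lt continuous_const continuous_re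
  have hloc : MeasureTheory.LocallyIntegrableOn B (Set.Ioi 0) := by
    apply MeasureTheory.LocallyIntegrable.locallyIntegrableOn
    intro x
    refine ⟨Metric.ball x 1, Metric.ball_mem_nhds x one_pos, ?_⟩
    refine MeasureTheory.Measure.integrableOn_of_bounded (M := 2 * q)
      (Metric.isBounded_ball.measure_lt_top).ne hmeas.aestronglyMeasurable ?_
    exact Eventually.of_forall fun t => hBb t
  have hd : DifferentiableOn ℂ (fun w => w * mellin B (-w)) {w : ℂ | 0 < w.re} := by
    intro w hw
    have hw' : 0 < w.re := hw
    have h1 : DifferentiableAt ℂ (mellin B) (-w) := by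
      refine mellin_differentiableAt_of_isBigO_rpow (a := 0) (b := -w.re - 1) hloc ?_
        (by simpa using hw') ?_ (by simp)
      · refine Asymptotics.IsBigO.of_bound (2 * q) (Eventually.of_forall fun t => ?_)
        simpa using hBb t
      · refine Asymptotics.IsBigO.of_bound 1 ?_
        filter_upwards [nhdsWithin_le_nhds (Iio_mem_nhds (show (0 : ℝ) < 1 by norm_num))] with t ht
        rw [hB1 t ht]
        simp
    exact (differentiableAt_id.mul (h1.comp w differentiable_neg.differentiableAt)).differentiableWithinAt
  have heq : Set.EqOn (LFunction χ) (fun w => w * mellin B (-w)) {w : ℂ | 0 < w.re} := by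
    refine AnalyticOnNhd.eqOn_of_preconnected_of_eventuallyEq (z₀ := 2)
      ((differentiable_LFunction hχ).differentiableOn.analyticOnNhd hU)
      (hd.analyticOnNhd hU) (convex_halfSpace_re_gt 0).isPreconnected (by simp) ?_
    have : {w : ℂ | 1 < w.re} ∈ 𝓝 (2 : ℂ) :=
      (isOpen_lt continuous_const continuous_re).mem_nhds (by simp)
    filter_upwards [this] with w hw
    have hw' : 1 < w.re := hw
    rw [LFunction_eq_LSeries χ hw', LSeries_eq_mul_integral (r := 0) _ le_rfl (by linarith)
      (LSeriesSummable_of_one_lt_re χ hw') ?_]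
    · rw [hmel]
    · refine Asymptotics.IsBigO.of_bound (2 * q) (Eventually.of_forall fun n => ?_)
      simpa using norm_sum_Icc_natCast_le hχ n
  rw [← hmel]
  exact heq hs

lemma norm_LFunction_le {χ : DirichletCharacter ℂ q} (hχ : χ ≠ 1) {s : ℂ} (hs : 0 < s.re) :
    ‖LFunction χ s‖ ≤ 2 * q * ‖s‖ / s.re := by
  have hle : ∀ t ∈ Set.Ioi (1 : ℝ), ‖(∑ k ∈ Finset.Icc 1 ⌊t⌋₊, χ (k : ZMod q)) *
      (t : ℂ) ^ (-(s + 1))‖ ≤ 2 * q * t ^ (-(s.re + 1)) := fun t ht => by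
    have ht' : (1 : ℝ) < t := ht
    rw [norm_mul, norm_cpow_eq_rpow_re_of_pos (by linarith)]
    have : (-(s + 1)).re = -(s.re + 1) := by simp
    rw [this]
    gcongr
    exact norm_sum_Icc_natCast_le hχ _
  have hint : MeasureTheory.IntegrableOn (fun t : ℝ => 2 * q * t ^ (-(s.re + 1))) (Set.Ioi 1) :=
    (integrableOn_Ioi_rpow_of_lt (by linarith) one_pos).const_mul _
  rw [LFunction_eq_mul_integral hχ hs, norm_mul]
  have h := MeasureTheory.norm_integral_le_of_norm_le hint
    ((MeasureTheory.ae_restrict_mem measurableSet_Ioi).mono hle)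
  rw [MeasureTheory.integral_const_mul, integral_Ioi_rpow_of_lt (by linarith) one_pos] at h
  have e : 2 * (q : ℝ) * (-1 ^ (-(s.re + 1) + 1) / (-(s.re + 1) + 1)) = 2 * q / s.re := by
    rw [Real.one_rpow]
    have : s.re ≠ 0 := hs.ne'
    have h2 : -(s.re + 1) + 1 = -s.re := by ring
    rw [h2]
    field_simp
  rw [e] at h
  calc _ ≤ ‖s‖ * (2 * q / s.re) := by gcongr
    _ = _ := by ring

end DirichletCharacter

lemma exists_eq_mul_exp_of_ne_zero_on_ball {f : ℂ → ℂ} {c : ℂ} {R : ℝ} (hR : 0 < R)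
    (hf : DifferentiableOn ℂ f (Metric.ball c R)) (hne : ∀ z ∈ Metric.ball c R, f z ≠ 0) :
    ∃ g : ℂ → ℂ, DifferentiableOn ℂ g (Metric.ball c R) ∧ g c = 0 ∧
      ∀ z ∈ Metric.ball c R, f z = f c * exp (g z) := by
  have hd : DifferentiableOn ℂ (logDeriv f) (Metric.ball c R) :=
    (hf.deriv Metric.isOpen_ball).div hf hne
  obtain ⟨g, hg⟩ := hd.isExactOn_ball
  have hc : c ∈ Metric.ball c R := Metric.mem_ball_self hR
  refine ⟨fun z => g z - g c, fun z hz => ((hg z hz).sub_const _).differentiableAt.differentiableWithinAt,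
    sub_self _, fun z hz => ?_⟩
  have hder : ∀ w ∈ Metric.ball c R, HasDerivAt (fun w => f w * exp (-g w)) 0 w := by
    intro w hw
    have h1 := (hf.differentiableAt (Metric.isOpen_ball.mem_nhds hw)).hasDerivAt
    refine (h1.mul (hg w hw).neg.cexp).congr_deriv ?_
    rw [logDeriv_apply]
    have := hne w hw
    field_simp
    ring
  have hconst := Metric.isOpen_ball.is_const_of_deriv_eq_zero
    (convex_ball c R).isPreconnected
    (fun w hw => (hder w hw).differentiableAt.differentiableWithinAt)
    (fun w hw => (hder w hw).deriv) hz hc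
  rw [Complex.exp_neg, Complex.exp_neg] at hconst
  rw [Complex.exp_sub]
  field_simp at hconst ⊢
  exact hconst

lemma LSeriesSummable.exists_norm_LSeries_le {f : ℕ → ℂ} {s₀ : ℂ} (h : LSeriesSummable f s₀) :
    ∃ Z : ℝ, 0 ≤ Z ∧ ∀ s : ℂ, s₀.re ≤ s.re → ‖LSeries f s‖ ≤ Z :=
  ⟨_, tsum_nonneg fun _ => norm_nonneg _, fun _ hs =>
    tsum_of_norm_bounded h.norm.hasSum fun n => LSeries.norm_term_le_of_re_le_re f hs n⟩

namespace DirichletCharacter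

variable {q : ℕ} [NeZero q]

lemma exists_bounds_of_three_halves_le_re (χ : DirichletCharacter ℂ q) :
    ∃ Z : ℝ, 0 < Z ∧ ∀ s : ℂ, 3 / 2 ≤ s.re → ‖LFunction χ s‖ ≤ Z ∧ ‖(LFunction χ s)⁻¹‖ ≤ Z ∧
      ‖logDeriv (LFunction χ) s‖ ≤ Z := by
  have h32 : 1 < ((3 / 2 : ℝ) : ℂ).re := by rw [ofReal_re]; norm_num
  obtain ⟨Z₁, p1, hZ₁⟩ := (LSeriesSummable_of_one_lt_re χ h32).exists_norm_LSeries_le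
  obtain ⟨Z₂, p2, hZ₂⟩ := (LSeriesSummable_mul χ
    (ArithmeticFunction.LSeriesSummable_moebius_iff.mpr h32)).exists_norm_LSeries_le
  obtain ⟨Z₃, p3, hZ₃⟩ := (LSeriesSummable_twist_vonMangoldt χ h32).exists_norm_LSeries_le
  refine ⟨Z₁ + Z₂ + Z₃ + 1, by positivity, fun s hs => ?_⟩
  have hs1 : 1 < s.re := by linarith
  have e0 : LFunction χ s = LSeries (fun n => χ (n : ZMod q)) s := LFunction_eq_LSeries χ hs1
  have hre : ((3 / 2 : ℝ) : ℂ).re ≤ s.re := by rw [ofReal_re]; exact hs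
  have b1 := hZ₁ s hre
  have b2 := hZ₂ s hre
  have b3 := hZ₃ s hre
  rw [eq_inv_of_mul_eq_one_right (LSeries.mul_mu_eq_one χ hs1)] at b2
  rw [LSeries_twist_vonMangoldt_eq χ hs1, neg_div, norm_neg] at b3
  rw [logDeriv_apply, deriv_LFunction_eq_deriv_LSeries χ hs1, e0]
  exact ⟨by linarith, by linarith, by linarith⟩

lemma exists_norm_LFunction_inv_le {χ : DirichletCharacter ℂ q} (hχ : χ ≠ 1)
    (h0 : ∀ s : ℂ, 1 / 2 < s.re → LFunction χ s ≠ 0) {δ : ℝ} (hδ : 0 < δ) :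
    ∃ B : ℝ, 0 < B ∧ ∀ w : ℂ, 1 / 2 + δ ≤ w.re → w.re ≤ 2 →
      ‖(LFunction χ w)⁻¹‖ ≤ Real.exp (B * (1 + |w.im|)) := by
  obtain ⟨Z, hZ0, hZ⟩ := exists_bounds_of_three_halves_le_re χ
  have hq : (0 : ℝ) < q := by exact_mod_cast NeZero.pos q
  refine ⟨2 * (16 * q * Z) * (3 / 2) / δ + Z, by positivity, fun w hw1 hw2 => ?_⟩
  set c : ℂ := 2 + w.im * I with hc
  have hcre : c.re = 2 := by simp [hc]
  have hcim : c.im = w.im := by simp [hc]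
  have hball : ∀ z ∈ Metric.ball (0 : ℂ) (3 / 2), 1 / 2 < (c + z).re ∧ ‖c + z‖ ≤ 4 * (1 + |w.im|) := by
    intro z hz
    have hz' : ‖z‖ < 3 / 2 := by simpa using hz
    constructor
    · have := (abs_le.mp ((abs_re_le_norm z))).1
      rw [add_re, hcre]; linarith
    · have h1 := norm_add_le c z
      have h2 := norm_le_abs_re_add_abs_im c
      rw [hcre, hcim] at h2
      have h3 : |(2 : ℝ)| = 2 := abs_of_pos (by norm_num)
      have := abs_nonneg w.im
      linarith
  have hadd : ∀ z ∈ Metric.ball c (3 / 2), z - c ∈ Metric.ball (0 : ℂ) (3 / 2) := fun z hz => by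
    simpa [dist_eq_norm] using hz
  obtain ⟨g, hg, hgc, hgL⟩ := exists_eq_mul_exp_of_ne_zero_on_ball (f := LFunction χ) (c := c)
    (R := 3 / 2) (by norm_num) (differentiable_LFunction hχ).differentiableOn
    fun z hz => h0 z (by have := (hball _ (hadd z hz)).1; simpa using this)
  have hmaps : ∀ z ∈ Metric.ball (0 : ℂ) (3 / 2), c + z ∈ Metric.ball c (3 / 2) := fun z hz => by
    simpa [dist_eq_norm] using hz
  have hLc := (hZ c (by rw [hcre]; norm_num)).2.1
  have hLc0 : LFunction χ c ≠ 0 := h0 c (by rw [hcre]; norm_num)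
  have himn := abs_nonneg w.im
  have hM : 0 < 16 * q * Z * (1 + |w.im|) := by positivity
  have hzw : w - c ∈ Metric.ball (0 : ℂ) (3 / 2) := by
    have : w - c = ((w.re - 2 : ℝ) : ℂ) := by
      apply Complex.ext <;> simp [hc]
    rw [mem_ball_zero_iff, this, norm_real, Real.norm_eq_abs, abs_of_nonpos (by linarith)]
    linarith
  have hzn : ‖w - c‖ ≤ 3 / 2 - δ := by
    have : w - c = ((w.re - 2 : ℝ) : ℂ) := by
      apply Complex.ext <;> simp [hc]
    rw [this, norm_real, Real.norm_eq_abs, abs_of_nonpos (by linarith)]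
    linarith
  have hBC := borelCaratheodory_zero (f := fun z => g (c + z)) hM
    (hg.comp (by fun_prop) hmaps) ?_ (by norm_num) hzw (by simpa using hgc)
  · have hgw : ‖g w‖ ≤ 2 * (16 * q * Z) * (3 / 2) / δ * (1 + |w.im|) := by
      refine (by simpa using hBC : ‖g w‖ ≤ _).trans ?_
      calc _ ≤ 2 * (16 * q * Z * (1 + |w.im|)) * (3 / 2) / δ := by
            gcongr <;> linarith
        _ = _ := by ring
    have hw' : LFunction χ w = LFunction χ c * exp (g w) := by
      have := hgL _ (hmaps _ hzw)
      simpa using this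
    rw [hw', mul_inv, norm_mul, ← Complex.exp_neg, Complex.norm_exp]
    have h1 : (-g w).re ≤ 2 * (16 * q * Z) * (3 / 2) / δ * (1 + |w.im|) :=
      (re_le_norm _).trans (by rwa [norm_neg])
    calc _ ≤ Z * Real.exp (2 * (16 * q * Z) * (3 / 2) / δ * (1 + |w.im|)) := by gcongr
      _ ≤ Real.exp (Z * (1 + |w.im|)) * Real.exp (2 * (16 * q * Z) * (3 / 2) / δ * (1 + |w.im|)) := by
        gcongr
        have := Real.add_one_le_exp (Z * (1 + |w.im|))
        nlinarith
      _ = _ := by rw [← Real.exp_add]; ring_nf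
  · intro z hz
    have hz1 := hball z hz
    show (g (c + z)).re ≤ _
    have h1 := hgL _ (hmaps z hz)
    have h2 : exp (g (c + z)) = LFunction χ (c + z) * (LFunction χ c)⁻¹ := by
      rw [h1]; field_simp
    have h3 : Real.exp (g (c + z)).re = ‖LFunction χ (c + z)‖ * ‖(LFunction χ c)⁻¹‖ := by
      rw [← norm_exp, h2, norm_mul]
    have h4 := Real.add_one_le_exp (g (c + z)).re
    have h5 : ‖LFunction χ (c + z)‖ ≤ 16 * q * (1 + |w.im|) := by
      refine (norm_LFunction_le hχ (by linarith [hz1.1])).trans ?_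
      rw [div_le_iff₀ (by linarith [hz1.1])]
      calc 2 * q * ‖c + z‖ ≤ 2 * q * (4 * (1 + |w.im|)) := by gcongr; exact hz1.2
        _ = 16 * q * (1 + |w.im|) * (1 / 2) := by ring
        _ ≤ _ := by gcongr; exact hz1.1.le
    have h6 : ‖LFunction χ (c + z)‖ * ‖(LFunction χ c)⁻¹‖ ≤ 16 * q * (1 + |w.im|) * Z := by gcongr
    nlinarith

end DirichletCharacter

namespace DirichletCharacter

variable {q : ℕ}

lemma gammaFactor_inv (χ : DirichletCharacter ℂ q) : gammaFactor χ⁻¹ = gammaFactor χ := by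
  have h1 : χ⁻¹ (-1) = star (χ (-1)) := (MulChar.star_apply' χ _).symm
  funext s
  rcases χ.even_or_odd with hχ | hχ
  · have : χ⁻¹.Even := by rw [Even, h1, hχ, star_one]
    rw [hχ.gammaFactor_def, this.gammaFactor_def]
  · have : χ⁻¹.Odd := by rw [Odd, h1, hχ, star_neg, star_one]
    rw [hχ.gammaFactor_def, this.gammaFactor_def]

lemma _root_.Complex.Gammaℝ_conj (s : ℂ) :
    Gammaℝ (starRingEnd ℂ s) = starRingEnd ℂ (Gammaℝ s) := by
  have hpi : (π : ℂ).arg ≠ π := by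
    rw [arg_ofReal_of_nonneg Real.pi_pos.le]; exact Real.pi_pos.ne
  have h : ∀ w : ℂ, (π : ℂ) ^ (starRingEnd ℂ w) = starRingEnd ℂ ((π : ℂ) ^ w) := fun w => by
    rw [cpow_conj _ _ hpi, conj_ofReal]
  rw [Gammaℝ_def, Gammaℝ_def, map_mul, ← h, ← Complex.Gamma_conj,
    map_div₀, map_div₀, map_neg, map_ofNat]

lemma gammaFactor_conj (χ : DirichletCharacter ℂ q) (s : ℂ) :
    gammaFactor χ (starRingEnd ℂ s) = starRingEnd ℂ (gammaFactor χ s) := by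
  rcases χ.even_or_odd with hχ | hχ
  · rw [hχ.gammaFactor_def, hχ.gammaFactor_def, Gammaℝ_conj]
  · rw [hχ.gammaFactor_def, hχ.gammaFactor_def, ← Gammaℝ_conj]
    simp

lemma gammaFactor_ne_zero (χ : DirichletCharacter ℂ q) {s : ℂ} (hs : 0 < s.re) :
    gammaFactor χ s ≠ 0 := by
  rcases χ.even_or_odd with hχ | hχ
  · rw [hχ.gammaFactor_def]
    exact Gammaℝ_ne_zero_of_re_pos hs
  · rw [hχ.gammaFactor_def]
    exact Gammaℝ_ne_zero_of_re_pos (by rw [add_re, one_re]; linarith)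

variable [NeZero q]

lemma completedLFunction_eq_mul_gammaFactor (χ : DirichletCharacter ℂ q) {s : ℂ} (hs : 0 < s.re) :
    completedLFunction χ s = LFunction χ s * gammaFactor χ s := by
  have hs0 : s ≠ 0 := by rintro rfl; simp at hs
  rw [LFunction_eq_completed_div_gammaFactor χ s (Or.inl hs0),
    div_mul_cancel₀ _ (gammaFactor_ne_zero χ hs)]

lemma LFunction_inv_conj_of_one_lt_re (χ : DirichletCharacter ℂ q) {s : ℂ} (hs : 1 < s.re) :
    LFunction χ⁻¹ (starRingEnd ℂ s) = starRingEnd ℂ (LFunction χ s) := by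
  rw [LFunction_eq_LSeries χ hs, LFunction_eq_LSeries _ (by rwa [conj_re]), LSeries, LSeries,
    Complex.conj_tsum]
  refine tsum_congr fun n => ?_
  rcases eq_or_ne n 0 with rfl | hn
  · simp
  · rw [LSeries.term_of_ne_zero hn, LSeries.term_of_ne_zero hn, map_div₀,
      cpow_conj _ _ (by rw [natCast_arg]; exact Real.pi_pos.ne), conj_natCast,
      ← MulChar.star_apply' χ, RCLike.star_def]

lemma completedLFunction_inv_conj {χ : DirichletCharacter ℂ q} (hχ : χ ≠ 1) (s : ℂ) :
    completedLFunction χ⁻¹ (starRingEnd ℂ s) = starRingEnd ℂ (completedLFunction χ s) := by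
  have hd : Differentiable ℂ (starRingEnd ℂ ∘ completedLFunction χ ∘ starRingEnd ℂ) := fun z =>
    ((differentiable_completedLFunction hχ) _).conj_conj.congr_of_eventuallyEq
      (Eventually.of_forall fun w => rfl) |> fun h => by simpa using h
  have h2 := differentiable_completedLFunction (inv_ne_one.mpr hχ)
  have key : completedLFunction χ⁻¹ = starRingEnd ℂ ∘ completedLFunction χ ∘ starRingEnd ℂ := by
    refine AnalyticOnNhd.eq_of_eventuallyEq (z₀ := 2) (fun z _ => h2.analyticAt z)
      (fun z _ => hd.analyticAt z) ?_
    have : ∀ᶠ z : ℂ in 𝓝 2, 1 < z.re :=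
      continuous_re.continuousAt.eventually (lt_mem_nhds (by simp))
    filter_upwards [this] with z hz
    have hz' : 1 < (starRingEnd ℂ z).re := by rwa [conj_re]
    rw [Function.comp_apply, Function.comp_apply,
      completedLFunction_eq_mul_gammaFactor _ (by linarith),
      completedLFunction_eq_mul_gammaFactor _ (by linarith), map_mul,
      ← LFunction_inv_conj_of_one_lt_re χ hz', ← gammaFactor_conj, conj_conj, gammaFactor_inv]
  rw [key]
  simp

lemma IsPrimitive.ne_one {χ : DirichletCharacter ℂ q} (hχ : χ.IsPrimitive) (hq : 1 < q) :
    χ ≠ 1 := by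
  rintro rfl
  rw [IsPrimitive, conductor_one] at hχ
  exact hq.ne hχ

lemma IsPrimitive.norm_completedLFunction_one_sub_conj {χ : DirichletCharacter ℂ q}
    (hχ : χ.IsPrimitive) (hq : 1 < q) (s : ℂ) :
    ‖completedLFunction χ (1 - starRingEnd ℂ s)‖ =
      (q : ℝ) ^ (s.re - 1 / 2) * ‖rootNumber χ‖ * ‖completedLFunction χ s‖ := by
  rw [hχ.completedLFunction_one_sub, completedLFunction_inv_conj (hχ.ne_one hq), norm_mul, norm_mul,
    norm_conj, norm_natCast_cpow_of_pos (by omega)]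
  simp

lemma IsPrimitive.norm_rootNumber {χ : DirichletCharacter ℂ q} (hχ : χ.IsPrimitive)
    (hq : 1 < q) : ‖rootNumber χ‖ = 1 := by
  have h1 := hχ.norm_completedLFunction_one_sub_conj hq 2
  have h2 := hχ.norm_completedLFunction_one_sub_conj hq (-1)
  have e1 : 1 - starRingEnd ℂ (2 : ℂ) = -1 := by
    rw [map_ofNat]; norm_num
  have e2 : 1 - starRingEnd ℂ (-1 : ℂ) = 2 := by
    rw [map_neg, map_one]; norm_num
  rw [e1] at h1
  rw [e2, h1] at h2
  have hne : ‖completedLFunction χ 2‖ ≠ 0 := by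
    rw [norm_ne_zero_iff, completedLFunction_eq_mul_gammaFactor _ (by simp)]
    exact mul_ne_zero (LFunction_ne_zero_of_one_le_re χ (Or.inl (hχ.ne_one hq)) (by simp))
      (gammaFactor_ne_zero χ (by simp))
  have hq0 : (0 : ℝ) < q := by exact_mod_cast (by omega : 0 < q)
  have h3 : (q : ℝ) ^ ((-1 : ℂ).re - 1 / 2) * (q : ℝ) ^ ((2 : ℂ).re - 1 / 2) = 1 := by
    rw [← Real.rpow_add hq0]; norm_num
  have h4 : ‖rootNumber χ‖ ^ 2 = 1 := by
    apply mul_right_cancel₀ hne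
    calc _ = ((q : ℝ) ^ ((-1 : ℂ).re - 1 / 2) * (q : ℝ) ^ ((2 : ℂ).re - 1 / 2)) *
          ‖rootNumber χ‖ ^ 2 * ‖completedLFunction χ 2‖ := by rw [h3, one_mul]
      _ = _ := by rw [one_mul]; linear_combination -h2
  exact (pow_eq_one_iff_of_nonneg (norm_nonneg _) two_ne_zero).mp h4

end DirichletCharacter

lemma Complex.exists_norm_Gamma_le_mul_norm_Gamma_add {δ u₀ : ℝ} (hδ : 0 < δ) (hu₀ : 0 < u₀) :
    ∃ K : ℝ, 0 ≤ K ∧ ∀ u : ℂ, u₀ ≤ u.re → ‖Complex.Gamma u‖ ≤ K * ‖Complex.Gamma (u + δ)‖ := by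
  have hint := (Complex.betaIntegral_convergent (u := u₀) (v := δ) (by simpa) (by simpa)).norm
  set J := ∫ x : ℝ in 0..1, ‖(x : ℂ) ^ ((u₀ : ℂ) - 1) * (1 - (x : ℂ)) ^ ((δ : ℂ) - 1)‖ with hJ
  have hJ0 : 0 ≤ J := intervalIntegral.integral_nonneg zero_le_one fun x _ => norm_nonneg _
  refine ⟨J / ‖Complex.Gamma δ‖, by positivity, fun u hu => ?_⟩
  have hB : ‖Complex.betaIntegral u δ‖ ≤ J := by
    refine intervalIntegral.norm_integral_le_of_norm_le zero_le_one
      (Eventually.of_forall fun x hx => ?_) hint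
    rw [norm_mul, norm_mul]
    refine mul_le_mul_of_nonneg_right ?_ (norm_nonneg _)
    rw [norm_cpow_eq_rpow_re_of_pos hx.1, norm_cpow_eq_rpow_re_of_pos hx.1]
    exact Real.rpow_le_rpow_of_exponent_ge hx.1 hx.2 (by simpa using hu)
  have hΓ : Complex.Gamma δ ≠ 0 := Complex.Gamma_ne_zero_of_re_pos (by simpa)
  have h := Complex.Gamma_mul_Gamma_eq_betaIntegral (s := u) (t := δ) (by linarith) (by simpa)
  rw [div_mul_eq_mul_div, le_div_iff₀ (norm_pos_iff.mpr hΓ), ← norm_mul, h, norm_mul, mul_comm]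
  gcongr

lemma Complex.exists_norm_Gammaℝ_le_mul_norm_Gammaℝ_add {δ u₀ : ℝ} (hδ : 0 < δ) (hu₀ : 0 < u₀) :
    ∃ K : ℝ, 0 ≤ K ∧ ∀ s : ℂ, u₀ ≤ s.re → ‖Gammaℝ s‖ ≤ K * ‖Gammaℝ (s + δ)‖ := by
  obtain ⟨K, hK, h⟩ := exists_norm_Gamma_le_mul_norm_Gamma_add (half_pos hδ) (half_pos hu₀)
  refine ⟨π ^ (δ / 2) * K, by positivity, fun s hs => ?_⟩
  have h1 := h (s / 2) (by rw [div_ofNat_re]; linarith)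
  have e1 : s / 2 + ((δ / 2 : ℝ) : ℂ) = (s + δ) / 2 := by push_cast; ring
  rw [e1] at h1
  rw [Gammaℝ_def, Gammaℝ_def, norm_mul, norm_mul, norm_cpow_eq_rpow_re_of_pos Real.pi_pos,
    norm_cpow_eq_rpow_re_of_pos Real.pi_pos]
  have e2 : (π : ℝ) ^ (-s / 2).re = π ^ (δ / 2) * π ^ (-(s + δ) / 2).re := by
    rw [← Real.rpow_add Real.pi_pos]
    congr 1
    simp only [div_ofNat_re, neg_re, add_re, ofReal_re]
    ring
  rw [e2]
  calc _ ≤ π ^ (δ / 2) * π ^ (-(s + δ) / 2).re * (K * ‖Complex.Gamma ((s + δ) / 2)‖) := by gcongr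
    _ = _ := by ring

namespace DirichletCharacter

lemma exists_norm_gammaFactor_le {q : ℕ} (χ : DirichletCharacter ℂ q) {δ u₀ : ℝ} (hδ : 0 < δ)
    (hu₀ : 0 < u₀) :
    ∃ K : ℝ, 0 ≤ K ∧ ∀ s : ℂ, u₀ ≤ s.re → ‖gammaFactor χ s‖ ≤ K * ‖gammaFactor χ (s + δ)‖ := by
  obtain ⟨K, hK, h⟩ := exists_norm_Gammaℝ_le_mul_norm_Gammaℝ_add hδ hu₀
  refine ⟨K, hK, fun s hs => ?_⟩
  rcases χ.even_or_odd with hχ | hχ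
  · rw [hχ.gammaFactor_def, hχ.gammaFactor_def]
    exact h s hs
  · rw [hχ.gammaFactor_def, hχ.gammaFactor_def, add_right_comm]
    exact h _ (by rw [add_re, one_re]; linarith)

variable {q : ℕ} [NeZero q] {χ : DirichletCharacter ℂ q}

lemma exists_norm_completedLFunction_le (hχ : χ ≠ 1)
    (h0 : ∀ s : ℂ, 1 / 2 < s.re → LFunction χ s ≠ 0) {δ : ℝ} (hδ : 0 < δ) (hδ' : δ < 1 / 4) :
    ∃ A B : ℝ, 0 ≤ A ∧ 0 < B ∧ ∀ w : ℂ, 1 / 2 ≤ w.re →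
      ‖completedLFunction χ (w - δ)‖ ≤
        A * ‖w - δ‖ * Real.exp (B * (1 + |w.im|)) * ‖completedLFunction χ (w + δ)‖ ∧
      (3 / 2 ≤ w.re - δ → ‖completedLFunction χ (w - δ)‖ ≤ A * ‖completedLFunction χ (w + δ)‖) := by
  obtain ⟨K, hK, hΓ⟩ := exists_norm_gammaFactor_le χ (δ := 2 * δ) (u₀ := 1 / 4) (by linarith)
    (by norm_num)
  obtain ⟨Z, hZ0, hZ⟩ := exists_bounds_of_three_halves_le_re χ
  obtain ⟨B, hB0, hB⟩ := exists_norm_LFunction_inv_le hχ h0 hδ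
  have hq : (0 : ℝ) < q := by exact_mod_cast NeZero.pos q
  refine ⟨8 * q * K * (1 + Z) + Z * K * Z, B, by positivity, hB0, fun w hw => ?_⟩
  have r1 : (w - δ).re = w.re - δ := by simp
  have r2 : (w + δ).re = w.re + δ := by simp
  have i2 : (w + δ).im = w.im := by simp
  have hL0 : LFunction χ (w + δ) ≠ 0 := h0 _ (by rw [r2]; linarith)
  rw [completedLFunction_eq_mul_gammaFactor χ (s := w - δ) (by rw [r1]; linarith),
    completedLFunction_eq_mul_gammaFactor χ (s := w + δ) (by rw [r2]; linarith), norm_mul, norm_mul]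
  have hg := hΓ (w - δ) (by rw [r1]; linarith)
  rw [show w - δ + ((2 * δ : ℝ) : ℂ) = w + δ by push_cast; ring] at hg
  have key : ∀ a b : ℝ, 0 ≤ a → ‖LFunction χ (w - δ)‖ ≤ a → ‖(LFunction χ (w + δ))⁻¹‖ ≤ b →
      ‖LFunction χ (w - δ)‖ * ‖gammaFactor χ (w - δ)‖ ≤
        a * K * b * (‖LFunction χ (w + δ)‖ * ‖gammaFactor χ (w + δ)‖) := by
    intro a b ha h1 h2
    have h3 : 1 ≤ b * ‖LFunction χ (w + δ)‖ := by
      rwa [norm_inv, inv_le_iff_one_le_mul₀ (norm_pos_iff.mpr hL0)] at h2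
    calc _ ≤ a * (K * ‖gammaFactor χ (w + δ)‖) := by gcongr
      _ ≤ a * (K * ‖gammaFactor χ (w + δ)‖) * (b * ‖LFunction χ (w + δ)‖) :=
        le_mul_of_one_le_right (by positivity) h3
      _ = _ := by ring
  have hE : 1 ≤ Real.exp (B * (1 + |w.im|)) := Real.one_le_exp (by positivity)
  constructor
  · have hb : ‖(LFunction χ (w + δ))⁻¹‖ ≤ (1 + Z) * Real.exp (B * (1 + |w.im|)) := by
      rcases le_total (w + δ).re 2 with h | h
      · have := hB (w + δ) (by rw [r2]; linarith) h
        rw [i2] at this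
        nlinarith
      · have := (hZ (w + δ) (by linarith)).2.1
        nlinarith
    have ha : ‖LFunction χ (w - δ)‖ ≤ 8 * q * ‖w - δ‖ := by
      refine (norm_LFunction_le hχ (by rw [r1]; linarith)).trans ?_
      rw [r1, div_le_iff₀ (by linarith)]
      calc 2 * q * ‖w - δ‖ = 8 * q * ‖w - δ‖ * (1 / 4) := by ring
        _ ≤ _ := by gcongr; linarith
    refine (key _ _ (by positivity) ha hb).trans ?_
    refine mul_le_mul_of_nonneg_right ?_ (by positivity)
    have : 0 ≤ Z * K * Z * (‖w - δ‖ * Real.exp (B * (1 + |w.im|))) := by positivity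
    nlinarith
  · intro hw3
    refine (key Z Z hZ0.le (hZ _ (by rw [r1]; linarith)).1
      (hZ _ (by rw [r2]; linarith)).2.1).trans ?_
    refine mul_le_mul_of_nonneg_right ?_ (by positivity)
    have : 0 ≤ 8 * q * K * (1 + Z) := by positivity
    linarith

lemma completedLFunction_ne_zero (h0 : ∀ s : ℂ, 1 / 2 < s.re → LFunction χ s ≠ 0) {s : ℂ}
    (hs : 1 / 2 < s.re) : completedLFunction χ s ≠ 0 := by
  rw [completedLFunction_eq_mul_gammaFactor χ (by linarith)]
  exact mul_ne_zero (h0 s hs) (gammaFactor_ne_zero χ (by linarith))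

lemma IsPrimitive.norm_completedLFunction_sub_le (hχ : χ.IsPrimitive) (hq : 1 < q)
    (h0 : ∀ s : ℂ, 1 / 2 < s.re → LFunction χ s ≠ 0) {δ : ℝ} (hδ : 0 < δ) (hδ' : δ < 1 / 4)
    {w : ℂ} (hw : 1 / 2 ≤ w.re) :
    ‖completedLFunction χ (w - δ)‖ ≤ (q : ℝ) ^ δ * ‖completedLFunction χ (w + δ)‖ := by
  obtain ⟨A, B, hA, hB, hAB⟩ := exists_norm_completedLFunction_le (hχ.ne_one hq) h0 hδ hδ'
  have hd := differentiable_completedLFunction (hχ.ne_one hq)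
  have hne : ∀ z : ℂ, 0 ≤ z.re → completedLFunction χ (1 / 2 + z + δ) ≠ 0 := fun z hz =>
    completedLFunction_ne_zero h0 (by simp; linarith)
  have hre : ∀ z : ℂ, (1 / 2 + z).re = 1 / 2 + z.re := fun z => by simp
  have him : ∀ z : ℂ, (1 / 2 + z).im = z.im := fun z => by simp
  set f : ℂ → ℂ := fun z => completedLFunction χ (1 / 2 + z - δ) / completedLFunction χ (1 / 2 + z + δ)
    with hf
  have hdf : DiffContOnCl ℂ f {z | 0 < z.re} := by
    refine DifferentiableOn.diffContOnCl fun z hz => ?_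
    have hz' : 0 ≤ z.re := by
      rw [closure_setOfPred_lt_re] at hz
      exact hz
    exact ((hd.comp (by fun_prop : Differentiable ℂ fun z : ℂ => 1 / 2 + z - δ)).differentiableAt.div
      (hd.comp (by fun_prop : Differentiable ℂ fun z : ℂ => 1 / 2 + z + δ)).differentiableAt
      (hne z hz')).differentiableWithinAt
  have hmain := PhragmenLindelof.right_half_plane_of_bounded_on_real (C := (q : ℝ) ^ δ) hdf
    ⟨1, by norm_num, B + 1, ?_⟩ ?_ ?_ (z := w - 1 / 2) (by simp; linarith)
  · have hw0 := hne (w - 1 / 2) (by simp; linarith)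
    simp only [hf, norm_div, add_sub_cancel] at hmain hw0
    rwa [div_le_iff₀ (norm_pos_iff.mpr hw0)] at hmain
  · refine Asymptotics.IsBigO.of_bound (A * Real.exp (B + 1)) ?_
    filter_upwards [mem_inf_of_right (mem_principal_self _)] with z hz
    have hz' : 0 ≤ z.re := le_of_lt hz
    have h1 := (hAB (1 / 2 + z) (by rw [hre]; linarith)).1
    simp only [hf, norm_div, Real.rpow_one, Real.norm_eq_abs, Real.abs_exp]
    rw [div_le_iff₀ (norm_pos_iff.mpr (hne z hz'))]
    refine h1.trans (mul_le_mul_of_nonneg_right ?_ (norm_nonneg _))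
    rw [him]
    have h2 : ‖1 / 2 + z - δ‖ ≤ Real.exp (‖z‖ + 1) := by
      have : ‖1 / 2 + z - δ‖ ≤ ‖((1 / 2 - δ : ℝ) : ℂ)‖ + ‖z‖ := by
        refine le_trans (le_of_eq ?_) (norm_add_le _ _)
        congr 1; push_cast; ring
      rw [norm_real, Real.norm_eq_abs, abs_of_pos (by linarith)] at this
      have := Real.add_one_le_exp (‖z‖ + 1)
      linarith
    calc _ ≤ A * Real.exp (‖z‖ + 1) * Real.exp (B * (1 + ‖z‖)) := by
          gcongr; exact abs_im_le_norm z
      _ = _ := by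
        rw [mul_assoc, mul_assoc, ← Real.exp_add, ← Real.exp_add]; ring_nf
  · refine ⟨A, ?_⟩
    rw [eventually_map]
    filter_upwards [eventually_ge_atTop (2 : ℝ)] with x hx
    have h1 := (hAB (1 / 2 + x) (by rw [hre, ofReal_re]; linarith)).2
      (by rw [hre, ofReal_re]; linarith)
    simp only [hf, norm_div]
    rwa [div_le_iff₀ (norm_pos_iff.mpr (hne x (by rw [ofReal_re]; linarith)))]
  · intro x
    simp only [hf, norm_div]
    rw [div_le_iff₀ (norm_pos_iff.mpr (hne _ (by simp)))]
    have h1 := hχ.norm_completedLFunction_one_sub_conj hq (1 / 2 + x * I + δ)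
    rw [hχ.norm_rootNumber hq, mul_one] at h1
    have e1 : 1 - starRingEnd ℂ (1 / 2 + x * I + δ) = 1 / 2 + x * I - δ := by
      simp only [map_add, map_mul, conj_I, conj_ofReal, map_div₀, map_one, map_ofNat]
      ring
    have e2 : (1 / 2 + x * I + δ).re - 1 / 2 = δ := by simp
    rw [e1, e2] at h1
    exact h1.le

end DirichletCharacter

namespace DirichletCharacter

variable {q : ℕ}

/-- The logarithmic derivative of the archimedean factor `q ^ (s / 2) * gammaFactor χ s`. -/
noncomputable def archimedeanLogDeriv (χ : DirichletCharacter ℂ q) (s : ℂ) : ℂ :=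
  Real.log q / 2 + logDeriv (gammaFactor χ) s

lemma _root_.Complex.logDeriv_Gammaℝ {s : ℂ} (hs : 0 < s.re) :
    logDeriv Gammaℝ s = -(Real.log π : ℂ) / 2 + digamma (s / 2) / 2 := by
  have hpi : (π : ℂ) ≠ 0 := by exact_mod_cast Real.pi_ne_zero
  have h2 : 0 < (s / 2).re := by rw [div_ofNat_re]; linarith
  have hΓ : DifferentiableAt ℂ Complex.Gamma (s / 2) := Complex.differentiableAt_Gamma _ fun m h => by
    rw [h] at h2
    simp at h2
    exact absurd h2 (not_lt.mpr m.cast_nonneg)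
  have hd1 : HasDerivAt (fun s : ℂ => (π : ℂ) ^ (-s / 2))
      ((π : ℂ) ^ (-s / 2) * Complex.log π * (-1 / 2)) s :=
    ((hasDerivAt_id s).neg.div_const 2).const_cpow (Or.inl hpi)
  have hd2 : HasDerivAt (fun s : ℂ => Complex.Gamma (s / 2))
      (deriv Complex.Gamma (s / 2) * (1 / 2)) s :=
    HasDerivAt.comp s hΓ.hasDerivAt ((hasDerivAt_id s).div_const 2)
  have hne : (π : ℂ) ^ (-s / 2) ≠ 0 := by rw [Ne, cpow_eq_zero_iff]; tauto
  have hne2 := Complex.Gamma_ne_zero_of_re_pos h2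
  have hfun : Gammaℝ = fun s : ℂ => (π : ℂ) ^ (-s / 2) * Complex.Gamma (s / 2) :=
    funext Gammaℝ_def
  rw [logDeriv_apply, hfun, (hd1.fun_mul hd2).deriv, digamma, logDeriv_apply, ofReal_log Real.pi_pos.le]
  field_simp

lemma exists_archimedeanLogDeriv_eq (χ : DirichletCharacter ℂ q) :
    ∃ a : ℝ, 0 ≤ a ∧ a ≤ 1 ∧ ∀ s : ℂ, 0 < s.re → archimedeanLogDeriv χ s =
      Real.log q / 2 - Real.log π / 2 + digamma ((s + a) / 2) / 2 := by
  rcases χ.even_or_odd with hχ | hχ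
  · refine ⟨0, le_rfl, zero_le_one, fun s hs => ?_⟩
    rw [archimedeanLogDeriv, show gammaFactor χ = Gammaℝ from funext hχ.gammaFactor_def,
      logDeriv_Gammaℝ hs, ofReal_zero, add_zero]
    ring
  · refine ⟨1, zero_le_one, le_rfl, fun s hs => ?_⟩
    have h1 : 0 < (s + 1).re := by rw [add_re, one_re]; linarith
    have : logDeriv (gammaFactor χ) s = logDeriv Gammaℝ (s + 1) := by
      rw [funext hχ.gammaFactor_def, logDeriv_apply, logDeriv_apply, deriv_comp_add_const]
    rw [archimedeanLogDeriv, this, logDeriv_Gammaℝ h1, ofReal_one]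
    ring

lemma exists_norm_archimedeanLogDeriv_sub_le : ∃ C : ℝ, 0 < C ∧
    ∀ (q : ℕ) (χ : DirichletCharacter ℂ q) (s w : ℂ), 1 / 2 ≤ s.re → 1 / 2 ≤ w.re →
      ‖archimedeanLogDeriv χ s - archimedeanLogDeriv χ w‖ ≤ C * √‖s - w‖ := by
  obtain ⟨C, hC, h⟩ := norm_digamma_sub_le_sqrt
  refine ⟨C, hC, fun q χ s w hs hw => ?_⟩
  obtain ⟨a, ha0, ha1, ha⟩ := exists_archimedeanLogDeriv_eq χ
  rw [ha s (by linarith), ha w (by linarith), add_sub_add_left_eq_sub, ← sub_div, norm_div,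
    RCLike.norm_ofNat]
  have h1 := h ((s + a) / 2) ((w + a) / 2) (by rw [div_ofNat_re, add_re, ofReal_re]; linarith)
    (by rw [div_ofNat_re, add_re, ofReal_re]; linarith)
  have e : (s + a) / 2 - (w + a) / 2 = (s - w) / 2 := by ring
  rw [e, norm_div, RCLike.norm_ofNat] at h1
  have h2 : √(‖s - w‖ / 2) ≤ √‖s - w‖ := Real.sqrt_le_sqrt (by linarith [norm_nonneg (s - w)])
  have h3 : C * √(‖s - w‖ / 2) ≤ C * √‖s - w‖ := by gcongr
  have h4 : 0 ≤ C * √‖s - w‖ := by positivity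
  linarith

lemma exists_abs_re_archimedeanLogDeriv_sub_log_le : ∃ C : ℝ, 0 < C ∧
    ∀ (q : ℕ) (χ : DirichletCharacter ℂ q) (s : ℂ), q ≠ 0 → 0 < s.re → s.re ≤ 2 → 2 ≤ s.im →
      |(archimedeanLogDeriv χ s).re - 1 / 2 * Real.log (q * (s.im + 1))| ≤ C := by
  obtain ⟨C, hC, h⟩ := abs_re_digamma_sub_log_le
  refine ⟨C + |Real.log π|, by positivity, fun q χ s hq hs hs2 ht => ?_⟩
  obtain ⟨a, ha0, ha1, ha⟩ := exists_archimedeanLogDeriv_eq χ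
  have h1 := h s.im ((s + a) / 2) ht (by rw [div_ofNat_re, add_re, ofReal_re]; linarith)
    (by rw [div_ofNat_re, add_re, ofReal_re]; linarith) (by simp)
  rw [ha s hs, Real.log_mul (by exact_mod_cast hq) (by linarith)]
  have e : ((Real.log q / 2 - Real.log π / 2 + digamma ((s + a) / 2) / 2 : ℂ)).re =
      Real.log q / 2 - Real.log π / 2 + (digamma ((s + a) / 2)).re / 2 := by
    rw [add_re, sub_re, div_ofNat_re, div_ofNat_re, div_ofNat_re, ofReal_re, ofReal_re]
  rw [e]
  have h2 := abs_le.mp h1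
  have h3 := abs_le.mp (le_refl |Real.log π|)
  exact abs_le.mpr ⟨by linarith, by linarith⟩

lemma differentiableOn_gammaFactor (χ : DirichletCharacter ℂ q) :
    DifferentiableOn ℂ (gammaFactor χ) {s | 0 < s.re} := by
  have hG : ∀ s : ℂ, 0 < s.re → DifferentiableAt ℂ Gammaℝ s := fun s hs => by
    have := (differentiable_Gammaℝ_inv s).fun_inv (inv_ne_zero (Gammaℝ_ne_zero_of_re_pos hs))
    simpa using this
  intro s hs
  have hs' : 0 < s.re := hs
  rcases χ.even_or_odd with hχ | hχ
  · rw [funext hχ.gammaFactor_def]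
    exact (hG s hs').differentiableWithinAt
  · rw [funext hχ.gammaFactor_def]
    have h1 : DifferentiableAt ℂ (fun s : ℂ => s + 1) s := by fun_prop
    exact (DifferentiableAt.comp s (hG (s + 1) (by rw [add_re, one_re]; linarith))
      h1).differentiableWithinAt

lemma differentiableOn_archimedeanLogDeriv (χ : DirichletCharacter ℂ q) :
    DifferentiableOn ℂ (archimedeanLogDeriv χ) {s | 0 < s.re} := by
  have ho : IsOpen {s : ℂ | 0 < s.re} := isOpen_lt continuous_const continuous_re
  have h := differentiableOn_gammaFactor χ
  exact ((h.deriv ho).div h fun s hs => gammaFactor_ne_zero χ hs).const_add _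

variable [NeZero q] {χ : DirichletCharacter ℂ q}

lemma differentiableOn_logDeriv_LFunction (hχ : χ ≠ 1)
    (h0 : ∀ s : ℂ, 1 / 2 < s.re → LFunction χ s ≠ 0) :
    DifferentiableOn ℂ (logDeriv (LFunction χ)) {s | 1 / 2 < s.re} := by
  have ho : IsOpen {s : ℂ | 1 / 2 < s.re} := isOpen_lt continuous_const continuous_re
  have h : DifferentiableOn ℂ (LFunction χ) {s | 1 / 2 < s.re} :=
    (differentiable_LFunction hχ).differentiableOn
  exact (h.deriv ho).div h fun s hs => h0 s hs

lemma logDeriv_completedLFunction_add (hχ : χ ≠ 1) {s : ℂ} (hs : 0 < s.re)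
    (h0 : LFunction χ s ≠ 0) :
    logDeriv (completedLFunction χ) s + Real.log q / 2 =
      logDeriv (LFunction χ) s + archimedeanLogDeriv χ s := by
  have ho : IsOpen {s : ℂ | 0 < s.re} := isOpen_lt continuous_const continuous_re
  have he : completedLFunction χ =ᶠ[𝓝 s] fun s => LFunction χ s * gammaFactor χ s := by
    filter_upwards [ho.mem_nhds hs] with w hw using completedLFunction_eq_mul_gammaFactor χ hw
  have : logDeriv (completedLFunction χ) s = logDeriv (fun s => LFunction χ s * gammaFactor χ s) s := by
    rw [logDeriv_apply, logDeriv_apply, he.deriv_eq, he.eq_of_nhds]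
  rw [this, logDeriv_mul _ h0 (gammaFactor_ne_zero χ hs) (differentiable_LFunction hχ s)
    ((differentiableOn_gammaFactor χ).differentiableAt (ho.mem_nhds hs)), archimedeanLogDeriv]
  ring

lemma IsPrimitive.re_logDeriv_LFunction_add_nonneg (hχ : χ.IsPrimitive) (hq : 1 < q)
    (h0 : ∀ s : ℂ, 1 / 2 < s.re → LFunction χ s ≠ 0) {w : ℂ} (hw : 1 / 2 < w.re) :
    0 ≤ (logDeriv (LFunction χ) w + archimedeanLogDeriv χ w).re := by
  rw [← logDeriv_completedLFunction_add (hχ.ne_one hq) (by linarith) (h0 w hw)]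
  have hq0 : (0 : ℝ) < q := by exact_mod_cast (by omega : 0 < q)
  set f := completedLFunction χ with hf
  have hfw : f w ≠ 0 := completedLFunction_ne_zero h0 hw
  have hd : HasDerivAt (fun δ : ℝ => f (w + δ)) (deriv f w) 0 := by
    have h1 : HasDerivAt f (deriv f w) (w + (0 : ℝ)) := by
      simpa using (differentiable_completedLFunction (hχ.ne_one hq) w).hasDerivAt
    have h2 : HasDerivAt (fun z : ℂ => f (w + z)) (deriv f w) ((0 : ℝ) : ℂ) :=
      HasDerivAt.comp_const_add _ _ h1
    exact h2.comp_ofReal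
  set φ : ℝ → ℝ := fun δ => ‖f (w + δ)‖ ^ 2 * (q : ℝ) ^ δ with hφ
  have hφd : HasDerivAt φ (2 * ‖f w‖ ^ 2 * (logDeriv f w + Real.log q / 2).re) 0 := by
    have h1 := hd.norm_sq.mul ((hasDerivAt_id (0 : ℝ)).const_rpow hq0)
    refine h1.congr_deriv ?_
    simp only [ofReal_zero, add_zero, Complex.inner, id, Real.rpow_zero, mul_one, add_re,
      div_ofNat_re, ofReal_re, logDeriv_apply]
    have h2 : deriv f w = f w * (deriv f w / f w) := by field_simp
    have h3 : (starRingEnd ℂ (f w) * deriv f w).re = ‖f w‖ ^ 2 * (deriv f w / f w).re := by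
      conv_lhs => rw [h2, ← mul_assoc, ← normSq_eq_conj_mul_self, re_ofReal_mul, normSq_eq_norm_sq]
    rw [mul_comm (deriv f w), h3]
    ring
  have hψ : HasDerivAt (fun δ => φ δ - φ (-δ))
      (4 * ‖f w‖ ^ 2 * (logDeriv f w + Real.log q / 2).re) 0 := by
    have h1 : HasDerivAt φ (2 * ‖f w‖ ^ 2 * (logDeriv f w + Real.log q / 2).re) (-(0 : ℝ)) := by rw [neg_zero]; exact hφd
    refine (hφd.sub (h1.comp (0 : ℝ) (hasDerivAt_neg 0))).congr_deriv ?_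
    ring
  have hpos : 0 ≤ 4 * ‖f w‖ ^ 2 * (logDeriv f w + Real.log q / 2).re := by
    refine ge_of_tendsto hψ.tendsto_slope_zero_right ?_
    filter_upwards [Ioo_mem_nhdsGT (show (0 : ℝ) < 1 / 4 by norm_num)] with δ hδ
    have h1 := hχ.norm_completedLFunction_sub_le hq h0 hδ.1 hδ.2 hw.le
    rw [← hf] at h1
    have h2 : φ (-δ) ≤ φ δ := by
      simp only [hφ, ofReal_neg, ← sub_eq_add_neg]
      calc ‖f (w - δ)‖ ^ 2 * (q : ℝ) ^ (-δ) ≤ ((q : ℝ) ^ δ * ‖f (w + δ)‖) ^ 2 * (q : ℝ) ^ (-δ) := by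
            gcongr
        _ = ‖f (w + δ)‖ ^ 2 * ((q : ℝ) ^ δ * ((q : ℝ) ^ δ * (q : ℝ) ^ (-δ))) := by ring
        _ = _ := by rw [← Real.rpow_add hq0, add_neg_cancel, Real.rpow_zero, mul_one]
    have hδ0 : 0 < δ := hδ.1
    rw [smul_eq_mul]
    simp only [zero_add, neg_zero, sub_self, sub_zero]
    exact mul_nonneg (by positivity) (sub_nonneg.mpr h2)
  exact nonneg_of_mul_nonneg_right hpos (by positivity)

end DirichletCharacter

namespace DirichletCharacter

variable {q : ℕ}

lemma exists_norm_archimedeanLogDeriv_le (χ : DirichletCharacter ℂ q) :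
    ∃ K : ℝ, 0 ≤ K ∧ ∀ w : ℂ, 1 / 2 ≤ w.re → ‖archimedeanLogDeriv χ w‖ ≤ K * √(1 + ‖w‖) := by
  obtain ⟨C, hC, h⟩ := exists_norm_archimedeanLogDeriv_sub_le
  refine ⟨C + ‖archimedeanLogDeriv χ 1‖, by positivity, fun w hw => ?_⟩
  have h1 := h q χ w 1 hw (by norm_num)
  have h2 : √‖w - 1‖ ≤ √(1 + ‖w‖) := Real.sqrt_le_sqrt (by
    have := norm_sub_le w 1
    rw [norm_one] at this
    linarith)
  have h3 : 1 ≤ √(1 + ‖w‖) := Real.one_le_sqrt.mpr (by linarith [norm_nonneg w])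
  have h4 := norm_le_norm_sub_add (archimedeanLogDeriv χ w) (archimedeanLogDeriv χ 1)
  have h5 : C * √‖w - 1‖ ≤ C * √(1 + ‖w‖) := by gcongr
  nlinarith [norm_nonneg (archimedeanLogDeriv χ 1)]

variable [NeZero q] {χ : DirichletCharacter ℂ q}

/-- The logarithmic derivative of `q ^ (s / 2) * gammaFactor χ s * LFunction χ s`. -/
noncomputable def xiLogDeriv (χ : DirichletCharacter ℂ q) (s : ℂ) : ℂ :=
  logDeriv (LFunction χ) s + archimedeanLogDeriv χ s

lemma differentiableOn_xiLogDeriv (hχ : χ ≠ 1) (h0 : ∀ s : ℂ, 1 / 2 < s.re → LFunction χ s ≠ 0) :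
    DifferentiableOn ℂ (xiLogDeriv χ) {s | 1 / 2 < s.re} :=
  (differentiableOn_logDeriv_LFunction hχ h0).add
    ((differentiableOn_archimedeanLogDeriv χ).mono fun s (hs : 1 / 2 < s.re) =>
      show 0 < s.re by linarith)

lemma IsPrimitive.exists_norm_xiLogDeriv_le (hχ : χ.IsPrimitive) (hq : 1 < q)
    (h0 : ∀ s : ℂ, 1 / 2 < s.re → LFunction χ s ≠ 0) {b : ℝ} (hb : 1 / 2 < b) :
    ∃ K : ℝ, 0 ≤ K ∧ ∀ w : ℂ, b ≤ w.re → ‖xiLogDeriv χ w‖ ≤ K * √(1 + ‖w‖) := by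
  obtain ⟨K, hK0, hK⟩ := exists_norm_archimedeanLogDeriv_le χ
  obtain ⟨Z, hZ0, hZ⟩ := exists_bounds_of_three_halves_le_re χ
  have hone : ∀ w : ℂ, 1 ≤ √(1 + ‖w‖) := fun w =>
    Real.one_le_sqrt.mpr (by linarith [norm_nonneg w])
  have hright : ∀ w : ℂ, 3 / 2 ≤ w.re → ‖xiLogDeriv χ w‖ ≤ (Z + K) * √(1 + ‖w‖) := fun w hw => by
    have h1 := norm_add_le (logDeriv (LFunction χ) w) (archimedeanLogDeriv χ w)
    have h2 := hK w (by linarith)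
    have h3 := (hZ w hw).2.2
    have h4 := hone w
    rw [xiLogDeriv]
    nlinarith
  have hbpos : 0 < b - 1 / 2 := by linarith
  refine ⟨(3 + 6 * (Z + K)) / (b - 1 / 2) + (Z + K), by positivity, fun w hw => ?_⟩
  have hw1 := hone w
  have hw0 : 0 ≤ √(1 + ‖w‖) := by positivity
  rcases le_total 2 w.re with h | h
  · refine (hright w (by linarith)).trans (mul_le_mul_of_nonneg_right ?_ hw0)
    have : 0 ≤ (3 + 6 * (Z + K)) / (b - 1 / 2) := by positivity
    linarith
  set c : ℂ := 2 + w.im * I with hc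
  have hcre : c.re = 2 := by simp [hc]
  have hcim : c.im = w.im := by simp [hc]
  have hzw : w - c = ((w.re - 2 : ℝ) : ℂ) := by
    apply Complex.ext <;> simp [hc]
  have hzn : ‖w - c‖ = 2 - w.re := by
    rw [hzw, norm_real, Real.norm_eq_abs, abs_of_nonpos (by linarith)]
    ring
  have hball : ∀ z ∈ Metric.ball (0 : ℂ) (3 / 2), 1 / 2 < (c + z).re := by
    intro z hz
    have hz' : ‖z‖ < 3 / 2 := by simpa using hz
    have := (abs_le.mp ((abs_re_le_norm z))).1
    rw [add_re, hcre]; linarith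
  have hBC := borelCaratheodory (f := fun z => -xiLogDeriv χ (c + z)) (M := 1) (R := 3 / 2)
    (z := w - c) one_pos
    ((((differentiableOn_xiLogDeriv (hχ.ne_one hq) h0).comp (by fun_prop) hball)).fun_neg)
    (fun z hz => by
      have := hχ.re_logDeriv_LFunction_add_nonneg hq h0 (hball z hz)
      show (-xiLogDeriv χ (c + z)).re ≤ 1
      rw [neg_re, xiLogDeriv]
      linarith) (by norm_num) (by rw [mem_ball_zero_iff, hzn]; linarith)
  simp only [add_sub_cancel, norm_neg, add_zero, mul_one] at hBC
  rw [hzn] at hBC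
  have hcw : ‖c‖ ≤ 2 + ‖w‖ := by
    have h1 := norm_add_le (2 : ℂ) (w.im * I)
    rw [← hc, norm_mul, norm_I, norm_real, mul_one, RCLike.norm_ofNat, Real.norm_eq_abs] at h1
    exact h1.trans (by linarith [abs_im_le_norm w])
  have hc1 : √(1 + ‖c‖) ≤ 2 * √(1 + ‖w‖) := by
    rw [show (2 : ℝ) = √(2 ^ 2) by rw [Real.sqrt_sq zero_le_two], ← Real.sqrt_mul (by norm_num)]
    exact Real.sqrt_le_sqrt (by linarith [norm_nonneg w])
  have hG := hright c (by rw [hcre]; norm_num)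
  have hG2 : ‖xiLogDeriv χ c‖ ≤ 2 * (Z + K) * √(1 + ‖w‖) := hG.trans (by
    calc _ ≤ (Z + K) * (2 * √(1 + ‖w‖)) := by gcongr
      _ = _ := by ring)
  have hden : b - 1 / 2 ≤ 3 / 2 - (2 - w.re) := by linarith
  calc _ ≤ _ := hBC
    _ ≤ 3 / (b - 1 / 2) + 2 * (Z + K) * √(1 + ‖w‖) * 3 / (b - 1 / 2) := by
      gcongr <;> linarith
    _ ≤ (3 + 6 * (Z + K)) / (b - 1 / 2) * √(1 + ‖w‖) := by
      rw [← add_div, div_mul_eq_mul_div]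
      gcongr
      nlinarith
    _ ≤ _ := by
      refine mul_le_mul_of_nonneg_right ?_ hw0
      linarith

end DirichletCharacter

open MeasureTheory

lemma integrable_one_add_abs_rpow {r : ℝ} (hr : 1 < r) :
    Integrable fun v : ℝ => (1 + |v|) ^ (-r) :=
  integrable_one_add_norm (by simpa using hr)

/-- A function on a half plane whose growth is at most that of `√‖w‖ / ‖w - s‖ ^ 2` away from `s`
decays like `‖w‖ ^ (-3 / 2)`. -/
lemma exists_norm_le_rpow_of_norm_le_sqrt_div {f : ℂ → ℂ} {a b : ℝ} (hab : a < b)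
    (hf : DifferentiableOn ℂ f {w | a < w.re}) {s : ℂ} {S : Set ℂ} (hS : ∀ w ∈ S, b ≤ w.re) {K : ℝ}
    (hK : ∀ w ∈ S, 1 ≤ ‖w - s‖ → ‖f w‖ ≤ K * √(1 + ‖w‖) / ‖w - s‖ ^ 2) :
    ∃ K' : ℝ, 0 ≤ K' ∧ ∀ w ∈ S, ‖f w‖ ≤ K' * (1 + ‖w‖) ^ (-(3 / 2) : ℝ) := by
  have hcomp : IsCompact (Metric.closedBall s 1 ∩ {w : ℂ | b ≤ w.re}) :=
    (isCompact_closedBall s 1).inter_right (isClosed_le continuous_const continuous_re)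
  obtain ⟨B, hB⟩ := hcomp.exists_bound_of_continuousOn
    (hf.continuousOn.mono fun w hw => lt_of_lt_of_le hab hw.2)
  have hpos : ∀ w : ℂ, (0 : ℝ) < 1 + ‖w‖ := fun w => by positivity
  refine ⟨|B| * (2 + ‖s‖) ^ (3 / 2 : ℝ) + |K| * (2 + ‖s‖) ^ 2, by positivity, fun w hw => ?_⟩
  have hpow : (0 : ℝ) ≤ (1 + ‖w‖) ^ (-(3 / 2) : ℝ) := by positivity
  rw [add_mul]
  rcases le_total ‖w - s‖ 1 with h | h
  · have h1 := hB w ⟨by rwa [Metric.mem_closedBall, dist_eq_norm], hS w hw⟩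
    have h2 : 1 + ‖w‖ ≤ 2 + ‖s‖ := by
      have := norm_le_norm_sub_add w s
      linarith
    have h3 : 1 ≤ (2 + ‖s‖) ^ (3 / 2 : ℝ) * (1 + ‖w‖) ^ (-(3 / 2) : ℝ) := by
      rw [Real.rpow_neg (hpos w).le, ← div_eq_mul_inv, one_le_div (by positivity)]
      gcongr
    have h4 : |B| ≤ |B| * ((2 + ‖s‖) ^ (3 / 2 : ℝ) * (1 + ‖w‖) ^ (-(3 / 2) : ℝ)) :=
      le_mul_of_one_le_right (abs_nonneg B) h3
    have h5 : 0 ≤ |K| * (2 + ‖s‖) ^ 2 * (1 + ‖w‖) ^ (-(3 / 2) : ℝ) := by positivity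
    have := le_abs_self B
    nlinarith
  · have h2 : 1 + ‖w‖ ≤ (2 + ‖s‖) * ‖w - s‖ := by
      have := norm_le_norm_sub_add w s
      nlinarith [norm_nonneg s]
    have h3 : √(1 + ‖w‖) / ‖w - s‖ ^ 2 ≤ (2 + ‖s‖) ^ 2 * (1 + ‖w‖) ^ (-(3 / 2) : ℝ) := by
      rw [div_le_iff₀ (by positivity)]
      have e : √(1 + ‖w‖) = (1 + ‖w‖) ^ 2 * (1 + ‖w‖) ^ (-(3 / 2) : ℝ) := by
        rw [Real.sqrt_eq_rpow, ← Real.rpow_natCast, ← Real.rpow_add (hpos w)]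
        norm_num
      rw [e]
      calc _ ≤ ((2 + ‖s‖) * ‖w - s‖) ^ 2 * (1 + ‖w‖) ^ (-(3 / 2) : ℝ) := by gcongr
        _ = _ := by ring
    have h4 : 0 ≤ |B| * (2 + ‖s‖) ^ (3 / 2 : ℝ) * (1 + ‖w‖) ^ (-(3 / 2) : ℝ) := by positivity
    calc _ ≤ K * √(1 + ‖w‖) / ‖w - s‖ ^ 2 := hK w hw h
      _ ≤ |K| * √(1 + ‖w‖) / ‖w - s‖ ^ 2 := by gcongr; exact le_abs_self K
      _ = |K| * (√(1 + ‖w‖) / ‖w - s‖ ^ 2) := by ring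
      _ ≤ |K| * ((2 + ‖s‖) ^ 2 * (1 + ‖w‖) ^ (-(3 / 2) : ℝ)) := by gcongr
      _ ≤ _ := by rw [← mul_assoc]; linarith

lemma continuous_vertical {f : ℂ → ℂ} {a b : ℝ} (hab : a < b)
    (hf : DifferentiableOn ℂ f {w | a < w.re}) : Continuous fun v : ℝ => f (b + v * I) :=
  hf.continuousOn.comp_continuous (by fun_prop) fun v => by simpa using hab

lemma one_add_norm_vertical_rpow_le (b v : ℝ) {r : ℝ} (hr : 0 ≤ r) :
    (1 + ‖(b : ℂ) + v * I‖) ^ (-r) ≤ (1 + |v|) ^ (-r) := by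
  refine Real.rpow_le_rpow_of_nonpos (by positivity) ?_ (by linarith)
  have := abs_im_le_norm ((b : ℂ) + v * I)
  simp only [add_im, ofReal_im, mul_im, ofReal_re, I_im, mul_one, I_re, mul_zero, add_zero,
    zero_add] at this
  linarith

lemma integrable_vertical {f : ℂ → ℂ} {a b : ℝ} (hab : a < b)
    (hf : DifferentiableOn ℂ f {w | a < w.re}) {K : ℝ} (hK0 : 0 ≤ K)
    (hK : ∀ w : ℂ, w.re = b → ‖f w‖ ≤ K * (1 + ‖w‖) ^ (-(3 / 2) : ℝ)) :
    Integrable fun v : ℝ => f (b + v * I) := by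
  refine ((integrable_one_add_abs_rpow (r := 3 / 2) (by norm_num)).const_mul K).mono'
    (continuous_vertical hab hf).aestronglyMeasurable (Eventually.of_forall fun v => ?_)
  refine (hK _ (by simp)).trans ?_
  refine mul_le_mul_of_nonneg_left ?_ hK0
  exact one_add_norm_vertical_rpow_le b v (r := 3 / 2) (by norm_num)

lemma integral_vertical_eq_of_norm_le {f : ℂ → ℂ} {a b c : ℝ} (hab : a < b) (hbc : b ≤ c)
    (hf : DifferentiableOn ℂ f {w | a < w.re}) {K : ℝ} (hK0 : 0 ≤ K)
    (hK : ∀ w : ℂ, b ≤ w.re → w.re ≤ c → ‖f w‖ ≤ K * (1 + ‖w‖) ^ (-(3 / 2) : ℝ)) :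
    ∫ v : ℝ, f (b + v * I) = ∫ v : ℝ, f (c + v * I) := by
  have hb := intervalIntegral_tendsto_integral
    (integrable_vertical hab hf hK0 fun w hw => hK w hw.ge (hw.le.trans hbc))
    tendsto_neg_atTop_atBot tendsto_id
  have hc := intervalIntegral_tendsto_integral
    (integrable_vertical (hab.trans_le hbc) hf hK0 fun w hw => hK w (hbc.trans hw.ge) hw.le)
    tendsto_neg_atTop_atBot tendsto_id
  have hhor : ∀ g : ℝ → ℝ, (∀ T, |g T| = |T|) →
      Tendsto (fun T : ℝ => ∫ u in b..c, f (u + g T * I)) atTop (𝓝 0) := by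
    intro g hg
    have hlim : Tendsto (fun T : ℝ => K * (1 + T) ^ (-(3 / 2) : ℝ) * |c - b|) atTop (𝓝 0) := by
      have h1 : Tendsto (fun T : ℝ => (1 + T) ^ (-(3 / 2) : ℝ)) atTop (𝓝 0) :=
        (tendsto_rpow_neg_atTop (by norm_num)).comp (tendsto_atTop_add_const_left _ 1 tendsto_id)
      simpa using (h1.const_mul K).mul_const |c - b|
    refine squeeze_zero_norm' ?_ hlim
    filter_upwards [eventually_ge_atTop 0] with T hT
    refine intervalIntegral.norm_integral_le_of_norm_le_const fun u hu => ?_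
    rw [Set.uIoc_of_le hbc] at hu
    refine (hK _ (by simpa using hu.1.le) (by simpa using hu.2)).trans ?_
    have := one_add_norm_vertical_rpow_le u (g T) (r := 3 / 2) (by norm_num)
    rw [hg, abs_of_nonneg hT] at this
    gcongr
  have hrect : ∀ T : ℝ, (∫ u in b..c, f (u + (-T : ℝ) * I)) - (∫ u in b..c, f (u + (T : ℝ) * I)) +
      I * (∫ v in (-T)..T, f (c + v * I)) - I * (∫ v in (-T)..T, f (b + v * I)) = 0 := by
    intro T
    have := integral_boundary_rect_eq_zero_of_differentiableOn f (b + (-T : ℝ) * I) (c + T * I)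
      (hf.mono fun w hw => by
        have h := hw.1
        simp only [add_re, ofReal_re, mul_re, ofReal_im, I_re, mul_zero, I_im, zero_mul, sub_self,
          add_zero, Set.mem_preimage, Set.uIcc_of_le hbc] at h
        exact hab.trans_le h.1)
    simpa using this
  have hl := (((hhor (fun T => -T) abs_neg).sub (hhor (fun T => T) fun _ => rfl)).add
    (hc.const_mul I)).sub (hb.const_mul I)
  have h0 := tendsto_nhds_unique (hl.congr fun T => hrect T) tendsto_const_nhds
  have h1 : I * (∫ v : ℝ, f (b + v * I)) = I * ∫ v : ℝ, f (c + v * I) := by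
    linear_combination -h0
  exact mul_left_cancel₀ I_ne_zero h1

lemma integral_vertical_eq {f : ℂ → ℂ} {a b c : ℝ} (hab : a < b) (hbc : b ≤ c)
    (hf : DifferentiableOn ℂ f {w | a < w.re}) {s : ℂ} {K : ℝ}
    (hK : ∀ w : ℂ, b ≤ w.re → w.re ≤ c → 1 ≤ ‖w - s‖ → ‖f w‖ ≤ K * √(1 + ‖w‖) / ‖w - s‖ ^ 2) :
    ∫ v : ℝ, f (b + v * I) = ∫ v : ℝ, f (c + v * I) := by
  obtain ⟨K', hK0, hK'⟩ := exists_norm_le_rpow_of_norm_le_sqrt_div hab hf (s := s)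
    (S := {w | b ≤ w.re ∧ w.re ≤ c}) (fun w hw => hw.1) fun w hw => hK w hw.1 hw.2
  exact integral_vertical_eq_of_norm_le hab hbc hf hK0 fun w h1 h2 => hK' w ⟨h1, h2⟩

lemma integral_vertical_eq_zero {f : ℂ → ℂ} {a b : ℝ} (hab : a < b)
    (hf : DifferentiableOn ℂ f {w | a < w.re}) {s : ℂ} {K : ℝ}
    (hK : ∀ w : ℂ, b ≤ w.re → 1 ≤ ‖w - s‖ → ‖f w‖ ≤ K * √(1 + ‖w‖) / ‖w - s‖ ^ 2) :
    ∫ v : ℝ, f (b + v * I) = 0 := by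
  obtain ⟨K', hK0, hK'⟩ := exists_norm_le_rpow_of_norm_le_sqrt_div hab hf (s := s)
    (S := {w | b ≤ w.re}) (fun w hw => hw) hK
  have hlim : Tendsto (fun c : ℝ => K' * (1 + c) ^ (-(1 / 4) : ℝ) *
      ∫ v : ℝ, (1 + |v|) ^ (-(5 / 4) : ℝ)) atTop (𝓝 0) := by
    have h1 : Tendsto (fun T : ℝ => (1 + T) ^ (-(1 / 4) : ℝ)) atTop (𝓝 0) :=
      (tendsto_rpow_neg_atTop (by norm_num)).comp (tendsto_atTop_add_const_left _ 1 tendsto_id)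
    simpa using (h1.const_mul K').mul_const (∫ v : ℝ, (1 + |v|) ^ (-(5 / 4) : ℝ))
  have hbound : ∀ᶠ c : ℝ in atTop, ‖∫ v : ℝ, f (b + v * I)‖ ≤ K' * (1 + c) ^ (-(1 / 4) : ℝ) *
      ∫ v : ℝ, (1 + |v|) ^ (-(5 / 4) : ℝ) := by
    filter_upwards [eventually_ge_atTop b, eventually_ge_atTop 0] with c hbc hc0
    rw [integral_vertical_eq_of_norm_le hab hbc hf hK0 fun w h1 _ => hK' w h1,
      ← integral_const_mul]
    refine norm_integral_le_of_norm_le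
      ((integrable_one_add_abs_rpow (by norm_num)).const_mul _) (Eventually.of_forall fun v => ?_)
    refine (hK' _ (by simpa using hbc)).trans ?_
    rw [mul_assoc]
    gcongr
    have e : (1 + ‖(c : ℂ) + v * I‖) ^ (-(3 / 2) : ℝ) = (1 + ‖(c : ℂ) + v * I‖) ^ (-(1 / 4) : ℝ) *
        (1 + ‖(c : ℂ) + v * I‖) ^ (-(5 / 4) : ℝ) := by
      rw [← Real.rpow_add (by positivity)]; norm_num
    rw [e]
    have h1 := one_add_norm_vertical_rpow_le c v (r := 5 / 4) (by norm_num)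
    have h2 : (1 + ‖(c : ℂ) + v * I‖) ^ (-(1 / 4) : ℝ) ≤ (1 + c) ^ (-(1 / 4) : ℝ) := by
      refine Real.rpow_le_rpow_of_nonpos (by positivity) ?_ (by norm_num)
      have := re_le_norm ((c : ℂ) + v * I)
      simp only [add_re, ofReal_re, mul_re, ofReal_im, I_re, mul_zero, I_im, zero_mul, sub_self,
        add_zero] at this
      linarith
    gcongr
  exact norm_le_zero_iff.mp (ge_of_tendsto hlim hbound)

lemma hasMellin_max_neg_log_zero {s : ℂ} (hs : 0 < s.re) :
    HasMellin (fun u : ℝ => ((max (-Real.log u) 0 : ℝ) : ℂ)) s (1 / s ^ 2) := by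
  set f : ℝ → ℂ := Set.indicator (Set.Ioc 0 1) fun _ => 1 with hf
  have hcongr : ∀ u ∈ Set.Ioi (0 : ℝ),
      ((max (-Real.log u) 0 : ℝ) : ℂ) = -(Real.log u • f u) := by
    intro u (hu : 0 < u)
    rcases le_or_gt u 1 with h | h
    · rw [hf, Set.indicator_of_mem (Set.mem_Ioc.mpr ⟨hu, h⟩), max_eq_left (by simpa using Real.log_nonpos hu.le h)]
      simp
    · rw [hf, Set.indicator_of_notMem (fun h' => h.not_ge h'.2),
        max_eq_right (by simpa using Real.log_nonneg h.le)]
      simp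
  have hloc : LocallyIntegrableOn f (Set.Ioi 0) := by
    refine Integrable.locallyIntegrable ?_ |>.locallyIntegrableOn _
    rw [hf, integrable_indicator_iff measurableSet_Ioc]
    simp
  have htop : f =O[atTop] (· ^ (-(s.re + 1))) := by
    have : f =ᶠ[atTop] fun _ => 0 := by
      filter_upwards [eventually_gt_atTop 1] with u hu
      exact Set.indicator_of_notMem (fun h' => hu.not_ge h'.2) _
    exact this.trans_isBigO (Asymptotics.isBigO_zero _ _)
  have hbot : f =O[𝓝[>] 0] (· ^ (-(0 : ℝ))) := by
    refine Asymptotics.IsBigO.of_bound 1 (Eventually.of_forall fun u => ?_)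
    rw [neg_zero, Real.rpow_zero, norm_one, mul_one, hf]
    exact (norm_indicator_le_norm_self _ _).trans (by simp)
  obtain ⟨hconv, hderiv⟩ := mellin_hasDerivAt_of_isBigO_rpow hloc htop (by linarith) hbot hs
  have hs0 : s ≠ 0 := fun h => by simp [h] at hs
  have hinv : mellin f =ᶠ[𝓝 s] fun z => z⁻¹ := by
    filter_upwards [continuous_re.continuousAt.eventually (lt_mem_nhds hs)] with z hz
    rw [(hasMellin_one_Ioc hz).2, one_div]
  have hval : mellin (fun u => Real.log u • f u) s = -(s ^ 2)⁻¹ :=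
    (hderiv.congr_of_eventuallyEq hinv.symm).unique (hasDerivAt_inv hs0)
  refine ⟨?_, ?_⟩
  · refine (integrableOn_congr_fun (fun u hu => ?_) measurableSet_Ioi).mpr hconv.neg
    simp only [hcongr u hu, Pi.neg_apply, smul_neg]
  · rw [mellin, setIntegral_congr_fun measurableSet_Ioi (g := fun u : ℝ =>
      -((u : ℂ) ^ (s - 1) • Real.log u • f u)) (fun u hu => by simp only [hcongr u hu, smul_neg]),
      integral_neg]
    rw [mellin] at hval
    rw [hval, neg_neg, one_div]

lemma integrable_inv_sq_add_sq {d : ℝ} (hd : d ≠ 0) :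
    Integrable fun v : ℝ => (v ^ 2 + d ^ 2)⁻¹ := by
  have h := (integrable_inv_one_add_sq.comp_div hd).const_mul (d ^ 2)⁻¹
  refine h.congr (Eventually.of_forall fun v => ?_)
  simp only
  rw [← mul_inv]
  congr 1
  field_simp
  ring

lemma integral_univ_inv_sq_add_sq {d : ℝ} (hd : 0 < d) : ∫ v : ℝ, (v ^ 2 + d ^ 2)⁻¹ = π / d := by
  have h : ∀ v : ℝ, (v ^ 2 + d ^ 2)⁻¹ = (d ^ 2)⁻¹ * (1 + (v / d) ^ 2)⁻¹ := fun v => by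
    rw [← mul_inv]
    congr 1
    field_simp
    ring
  simp_rw [h]
  rw [integral_const_mul, Measure.integral_comp_div (fun v : ℝ => (1 + v ^ 2)⁻¹),
    integral_univ_inv_one_add_sq, abs_of_pos hd, smul_eq_mul]
  field_simp

lemma norm_add_mul_I_sq (c v : ℝ) : ‖(c : ℂ) + v * I‖ ^ 2 = v ^ 2 + c ^ 2 := by
  rw [← normSq_eq_norm_sq, normSq_add_mul_I]
  ring

lemma norm_exp_mul_div_sq (L : ℝ) (z : ℂ) :
    ‖cexp (L * z) / z ^ 2‖ = Real.exp (L * z.re) / ‖z‖ ^ 2 := by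
  rw [norm_div, norm_pow, Complex.norm_exp, re_ofReal_mul]

lemma integrable_exp_mul_div_sq (L : ℝ) {c : ℝ} (hc : c ≠ 0) :
    Integrable fun v : ℝ => cexp (L * (c + v * I)) / (c + v * I) ^ 2 := by
  refine ((integrable_inv_sq_add_sq hc).const_mul (Real.exp (L * c))).mono' ?_
    (Eventually.of_forall fun v => ?_)
  · refine Continuous.aestronglyMeasurable (Continuous.div (by fun_prop) (by fun_prop) fun v => ?_)
    refine pow_ne_zero 2 fun h => hc ?_
    simpa using congrArg re h
  · rw [norm_exp_mul_div_sq, norm_add_mul_I_sq, div_eq_mul_inv]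
    simp

lemma integral_exp_mul_div_sq (L : ℝ) {c : ℝ} (hc : 0 < c) :
    ∫ v : ℝ, cexp (L * (c + v * I)) / (c + v * I) ^ 2 = (2 * π * max L 0 : ℝ) := by
  have hc' : ∀ v : ℝ, 0 < ((c : ℂ) + v * I).re := fun v => by simpa using hc
  have hM : ∀ v : ℝ, mellin (fun u : ℝ => ((max (-Real.log u) 0 : ℝ) : ℂ)) (c + v * I) =
      1 / (c + v * I) ^ 2 := fun v => (hasMellin_max_neg_log_zero (hc' v)).2
  have hpos := Real.exp_pos (-L)
  have key := mellinInv_mellin_eq c (fun u : ℝ => ((max (-Real.log u) 0 : ℝ) : ℂ)) hpos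
    (hasMellin_max_neg_log_zero (by simpa using hc)).1
    (by
      have := integrable_exp_mul_div_sq 0 hc.ne'
      rw [VerticalIntegrable]
      simp_rw [hM]
      simpa using this)
    (by
      refine continuous_ofReal.continuousAt.comp ?_
      exact ((Real.continuousAt_log hpos.ne').neg).max continuousAt_const)
  rw [mellinInv] at key
  simp_rw [hM] at key
  have hint : ∀ v : ℝ, ((Real.exp (-L) : ℝ) : ℂ) ^ (-((c : ℂ) + v * I)) • (1 / ((c : ℂ) + v * I) ^ 2)
      = cexp (L * (c + v * I)) / (c + v * I) ^ 2 := fun v => by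
    rw [cpow_def_of_ne_zero (by exact_mod_cast hpos.ne'), ← Complex.ofReal_log hpos.le,
      Real.log_exp, smul_eq_mul, mul_one_div]
    push_cast
    ring_nf
  simp_rw [hint, Real.log_exp, neg_neg] at key
  rw [Complex.real_smul] at key
  have hpi : ((1 / (2 * π) : ℝ) : ℂ) ≠ 0 := by
    exact_mod_cast (by positivity : (1 / (2 * π) : ℝ) ≠ 0)
  refine mul_left_cancel₀ hpi (key.trans ?_)
  norm_cast
  field_simp

lemma integral_exp_mul_div_sq_of_neg (L : ℝ) {c : ℝ} (hc : c < 0) :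
    ∫ v : ℝ, cexp (L * (c + v * I)) / (c + v * I) ^ 2 = (2 * π * max (-L) 0 : ℝ) := by
  rw [← integral_exp_mul_div_sq (-L) (neg_pos.mpr hc), ← integral_neg_eq_self]
  refine integral_congr_ae (Eventually.of_forall fun v => ?_)
  simp only
  congr 1
  · congr 1
    push_cast
    ring
  · push_cast
    ring

/-- The kernel `(e ^ (2 * L * z) - e ^ (L * z)) / (L * z ^ 2)`, whose inverse Mellin transform is the
trapezoidal weight defining Selberg's truncated von Mangoldt function with `L = log x`. -/
noncomputable def selbergKernel (L : ℝ) (z : ℂ) : ℂ :=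
  (cexp (2 * L * z) - cexp (L * z)) / (L * z ^ 2)

lemma selbergKernel_mul_exp (L a : ℝ) (z : ℂ) : selbergKernel L z * cexp (-(a * z)) =
    (L : ℂ)⁻¹ * (cexp ((2 * L - a : ℝ) * z) / z ^ 2 - cexp ((L - a : ℝ) * z) / z ^ 2) := by
  have h1 : cexp ((2 * L - a : ℝ) * z) = cexp (2 * L * z) * cexp (-(a * z)) := by
    rw [← Complex.exp_add]; push_cast; ring_nf
  have h2 : cexp ((L - a : ℝ) * z) = cexp (L * z) * cexp (-(a * z)) := by
    rw [← Complex.exp_add]; push_cast; ring_nf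
  rw [h1, h2, selbergKernel, div_eq_mul_inv, mul_inv]
  ring

lemma differentiableOn_selbergKernel {L : ℝ} (hL : L ≠ 0) :
    DifferentiableOn ℂ (selbergKernel L) {z | z ≠ 0} := by
  intro z (hz : z ≠ 0)
  refine DifferentiableAt.differentiableWithinAt ?_
  unfold selbergKernel
  have : (L : ℂ) * z ^ 2 ≠ 0 := mul_ne_zero (by exact_mod_cast hL) (pow_ne_zero 2 hz)
  fun_prop (disch := assumption)

lemma norm_selbergKernel_le {L : ℝ} (hL : 0 < L) (z : ℂ) : ‖selbergKernel L z‖ ≤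
    Real.exp (L * z.re) * (1 + Real.exp (L * z.re)) / L * (‖z‖ ^ 2)⁻¹ := by
  rw [selbergKernel, norm_div, norm_mul, norm_pow, norm_real, Real.norm_eq_abs, abs_of_pos hL,
    ← div_eq_mul_inv, div_div]
  gcongr
  refine (norm_sub_le _ _).trans ?_
  have h1 : ‖cexp (2 * L * z)‖ = Real.exp (L * z.re) * Real.exp (L * z.re) := by
    rw [Complex.norm_exp, ← Real.exp_add]
    congr 1
    rw [show (2 * L : ℂ) = (2 * L : ℝ) by push_cast; ring, re_ofReal_mul]
    ring
  rw [h1, Complex.norm_exp, re_ofReal_mul]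
  linarith

lemma integrable_selbergKernel_mul_exp (L a : ℝ) {c : ℝ} (hc : c ≠ 0) : Integrable fun v : ℝ =>
    selbergKernel L (c + v * I) * cexp (-(a * (c + v * I))) := by
  simp_rw [selbergKernel_mul_exp]
  exact ((integrable_exp_mul_div_sq _ hc).sub (integrable_exp_mul_div_sq _ hc)).const_mul _

lemma integral_selbergKernel_mul_exp (L a : ℝ) {c : ℝ} (hc : 0 < c) :
    ∫ v : ℝ, selbergKernel L (c + v * I) * cexp (-(a * (c + v * I))) =
      (2 * π * ((max (2 * L - a) 0 - max (L - a) 0) / L) : ℝ) := by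
  simp_rw [selbergKernel_mul_exp]
  rw [integral_const_mul, integral_sub (integrable_exp_mul_div_sq _ hc.ne')
    (integrable_exp_mul_div_sq _ hc.ne'), integral_exp_mul_div_sq _ hc,
    integral_exp_mul_div_sq _ hc]
  push_cast
  ring

lemma integrable_selbergKernel (L : ℝ) {c : ℝ} (hc : c ≠ 0) :
    Integrable fun v : ℝ => selbergKernel L (c + v * I) := by
  simpa using integrable_selbergKernel_mul_exp L 0 hc

lemma integral_selbergKernel {L : ℝ} (hL : 0 < L) {c : ℝ} (hc : 0 < c) :
    ∫ v : ℝ, selbergKernel L (c + v * I) = (2 * π : ℝ) := by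
  have h := integral_selbergKernel_mul_exp L 0 hc
  rw [sub_zero, sub_zero, max_eq_left (by positivity), max_eq_left hL.le] at h
  simp only [ofReal_zero, zero_mul, neg_zero, Complex.exp_zero, mul_one] at h
  rw [h]
  congr 1
  field_simp
  ring

lemma integral_selbergKernel_of_neg {L : ℝ} (hL : 0 < L) {c : ℝ} (hc : c < 0) :
    ∫ v : ℝ, selbergKernel L (c + v * I) = 0 := by
  have h : ∀ z : ℂ, selbergKernel L z =
      (L : ℂ)⁻¹ * (cexp ((2 * L : ℝ) * z) / z ^ 2 - cexp (L * z) / z ^ 2) := fun z => by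
    simpa using selbergKernel_mul_exp L 0 z
  simp_rw [h]
  rw [integral_const_mul, integral_sub (integrable_exp_mul_div_sq _ hc.ne)
    (integrable_exp_mul_div_sq _ hc.ne), integral_exp_mul_div_sq_of_neg _ hc,
    integral_exp_mul_div_sq_of_neg _ hc, max_eq_right (by linarith), max_eq_right (by linarith)]
  simp

lemma LSeries.term_add_right (f : ℕ → ℂ) (s z : ℂ) (n : ℕ) :
    LSeries.term f (s + z) n = LSeries.term f s n * cexp (-(Real.log n * z)) := by
  rcases eq_or_ne n 0 with rfl | hn
  · simp
  have hn' : (n : ℂ) ≠ 0 := by exact_mod_cast hn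
  rw [LSeries.term_of_ne_zero hn, LSeries.term_of_ne_zero hn, cpow_add _ _ hn', Complex.exp_neg,
    cpow_def_of_ne_zero hn' z, Complex.ofReal_log (Nat.cast_nonneg n), ofReal_natCast]
  field_simp

lemma integral_selbergKernel_mul_LSeries (L : ℝ) {f : ℕ → ℂ} {s : ℂ} {c : ℝ} (hc : 0 < c)
    (hf : LSeriesSummable f (s + c)) :
    ∫ v : ℝ, selbergKernel L (c + v * I) * LSeries f (s + (c + v * I)) =
      ∑' n : ℕ, LSeries.term f s n *
        (2 * π * ((max (2 * L - Real.log n) 0 - max (L - Real.log n) 0) / L) : ℝ) := by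
  have hterm : ∀ (n : ℕ) (v : ℝ), selbergKernel L (c + v * I) * LSeries.term f (s + (c + v * I)) n =
      LSeries.term f s n *
        (selbergKernel L (c + v * I) * cexp (-(Real.log n * (c + v * I)))) := fun n v => by
    rw [LSeries.term_add_right]; ring
  have hnorm : ∀ (n : ℕ) (v : ℝ),
      ‖selbergKernel L (c + v * I) * LSeries.term f (s + (c + v * I)) n‖ =
        ‖LSeries.term f (s + c) n‖ * ‖selbergKernel L (c + v * I)‖ := fun n v => by
    rw [norm_mul, mul_comm, LSeries.norm_term_eq, LSeries.norm_term_eq]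
    simp
  have hsum := hasSum_integral_of_summable_integral_norm
    (F := fun (n : ℕ) (v : ℝ) =>
      selbergKernel L (c + v * I) * LSeries.term f (s + (c + v * I)) n)
    (μ := volume) (fun n => by
      simp_rw [hterm]
      exact (integrable_selbergKernel_mul_exp L _ hc.ne').const_mul _)
    (by
      simp_rw [hnorm, integral_const_mul]
      exact hf.norm.mul_right _)
  simp_rw [LSeries, ← tsum_mul_left]
  rw [← hsum.tsum_eq]
  refine tsum_congr fun n => ?_
  simp_rw [hterm]
  rw [integral_const_mul, integral_selbergKernel_mul_exp L _ hc]

lemma sqrt_one_add_norm_add_le (a z : ℂ) :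
    √(1 + ‖a + z‖) ≤ √(1 + ‖a‖) * √(1 + ‖z‖) := by
  rw [← Real.sqrt_mul (by positivity)]
  refine Real.sqrt_le_sqrt ?_
  nlinarith [norm_add_le a z, norm_nonneg a, norm_nonneg z]

lemma exists_norm_sub_le_sqrt {F : ℂ → ℂ} {s : ℂ} {b K : ℝ}
    (hK : ∀ w : ℂ, b ≤ w.re → ‖F w‖ ≤ K * √(1 + ‖w‖)) :
    ∃ K' : ℝ, 0 ≤ K' ∧ ∀ z : ℂ, b ≤ (s + z).re → ‖F (s + z) - F s‖ ≤ K' * √(1 + ‖z‖) := by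
  refine ⟨|K| * √(1 + ‖s‖) + ‖F s‖, by positivity, fun z hz => ?_⟩
  have h3 := sqrt_one_add_norm_add_le s z
  have h4 := hK (s + z) hz
  have h5 : 1 ≤ √(1 + ‖z‖) := Real.one_le_sqrt.mpr (by linarith [norm_nonneg z])
  refine (norm_sub_le _ _).trans ?_
  rw [add_mul, mul_assoc]
  refine add_le_add (h4.trans ?_) (le_mul_of_one_le_right (norm_nonneg _) h5)
  gcongr
  exact le_abs_self K

lemma vertical_ne_zero {c : ℝ} (hc : c ≠ 0) (v : ℝ) : (c : ℂ) + v * I ≠ 0 := fun h =>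
  hc (by simpa using congrArg re h)

lemma Lambdax_eq_mul {x : ℝ} (hx : 1 < x) (n : ℕ) : Lambdax x n =
    vonMangoldt n * ((max (2 * Real.log x - Real.log n) 0 - max (Real.log x - Real.log n) 0) /
      Real.log x) := by
  rcases eq_or_ne n 0 with rfl | hn
  · simp [Lambdax]
  have hL : 0 < Real.log x := Real.log_pos hx
  have hn0 : (0 : ℝ) < n := by exact_mod_cast hn.bot_lt
  have hx0 : 0 < x := by linarith
  have h2 : Real.log (x ^ 2) = 2 * Real.log x := by rw [Real.log_pow]; norm_num
  rw [Lambdax]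
  split_ifs with h h'
  · have := Real.log_le_log hn0 h
    rw [max_eq_left (by linarith), max_eq_left (by linarith)]
    field_simp
    ring
  · have h3 := Real.log_le_log hn0 h'
    have h4 := Real.log_le_log hx0 (not_le.mp h).le
    rw [h2] at h3
    rw [max_eq_left (by linarith), max_eq_right (by linarith), sub_zero,
      Real.log_div (by positivity) hn0.ne', h2]
  · have h3 := Real.log_le_log (by positivity) (not_le.mp h').le
    rw [h2] at h3
    rw [max_eq_right (by linarith), max_eq_right (by linarith)]
    simp

lemma tsum_term_mul_eq_Dpoly {q : ℕ} (χ : DirichletCharacter ℂ q) {x : ℝ} (hx : 1 < x) (s : ℂ) :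
    ∑' n : ℕ, LSeries.term (fun n => χ n * vonMangoldt n) s n *
      (2 * π * ((max (2 * Real.log x - Real.log n) 0 - max (Real.log x - Real.log n) 0) /
        Real.log x) : ℝ) = 2 * π * Dpoly χ x s := by
  have hterm : ∀ n : ℕ, LSeries.term (fun n => χ n * vonMangoldt n) s n *
      (2 * π * ((max (2 * Real.log x - Real.log n) 0 - max (Real.log x - Real.log n) 0) /
        Real.log x) : ℝ) = 2 * π * ((Lambdax x n : ℂ) * χ n / (n : ℂ) ^ s) := fun n => by
    rw [Lambdax_eq_mul hx]
    rcases eq_or_ne n 0 with rfl | hn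
    · simp
    rw [LSeries.term_of_ne_zero hn]
    push_cast
    ring
  simp_rw [hterm]
  rw [tsum_mul_left, Dpoly]
  congr 1
  refine tsum_eq_sum fun n hn => ?_
  have hn' : x ^ 2 ≤ n := by
    by_contra! h
    refine hn (Finset.mem_filter.mpr ⟨Finset.mem_range.mpr ?_, h⟩)
    have := h.trans_le (Nat.le_ceil _)
    exact Nat.lt_succ_of_lt (by exact_mod_cast this)
  have hx2 : x ≤ x ^ 2 := by nlinarith
  rw [Lambdax]
  split_ifs with h1 h2
  · nlinarith
  · rw [le_antisymm h2 hn', div_self (by positivity)]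
    simp
  · simp

lemma integrable_sqrt_div_sq {c : ℝ} (hc : c ≠ 0) :
    Integrable fun v : ℝ => √(1 + ‖(c : ℂ) + v * I‖) / ‖(c : ℂ) + v * I‖ ^ 2 := by
  refine ((integrable_one_add_abs_rpow (r := 3 / 2) (by norm_num)).const_mul
    ((1 + |c|⁻¹) ^ 2)).mono' ?_ (Eventually.of_forall fun v => ?_)
  · exact Continuous.aestronglyMeasurable (Continuous.div (by fun_prop) (by fun_prop) fun v =>
      pow_ne_zero 2 (norm_ne_zero_iff.mpr (vertical_ne_zero hc v)))
  · have hle : |c| ≤ ‖(c : ℂ) + v * I‖ := by simpa using abs_re_le_norm ((c : ℂ) + v * I)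
    have h1 := one_add_norm_vertical_rpow_le c v (r := 3 / 2) (by norm_num)
    set r := ‖(c : ℂ) + v * I‖
    have hc0 : 0 < |c| := abs_pos.mpr hc
    have hr : 0 < r := hc0.trans_le hle
    have h2 : 1 + r ≤ (1 + |c|⁻¹) * r := by
      have : 1 ≤ |c|⁻¹ * r := by rwa [inv_mul_eq_div, one_le_div hc0]
      linarith
    have e : √(1 + r) = (1 + r) ^ 2 * (1 + r) ^ (-(3 / 2) : ℝ) := by
      rw [Real.sqrt_eq_rpow, ← Real.rpow_natCast, ← Real.rpow_add (by positivity)]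
      norm_num
    rw [Real.norm_of_nonneg (by positivity), div_le_iff₀ (by positivity), e]
    calc _ ≤ ((1 + |c|⁻¹) * r) ^ 2 * (1 + |v|) ^ (-(3 / 2) : ℝ) := by gcongr
      _ = _ := by ring

lemma integrable_selbergKernel_mul {L : ℝ} (hL : 0 < L) {c : ℝ} (hc : c ≠ 0) {s : ℂ} {F : ℝ → ℂ}
    (hF : Continuous F) {K : ℝ} (hK0 : 0 ≤ K) (hK : ∀ v : ℝ, ‖F v‖ ≤ K * √(1 + ‖s + (c + v * I)‖)) :
    Integrable fun v : ℝ => selbergKernel L (c + v * I) * F v := by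
  have hcont : Continuous fun v : ℝ => selbergKernel L (c + v * I) :=
    (differentiableOn_selbergKernel hL.ne').continuousOn.comp_continuous (by fun_prop) (vertical_ne_zero hc)
  refine ((integrable_sqrt_div_sq hc).const_mul
    (Real.exp (L * c) * (1 + Real.exp (L * c)) / L * (K * √(1 + ‖s‖)))).mono'
    (hcont.mul hF).aestronglyMeasurable (Eventually.of_forall fun v => ?_)
  have h1 := norm_selbergKernel_le hL (c + v * I)
  have h2 := sqrt_one_add_norm_add_le s (c + v * I)
  simp only [add_re, ofReal_re, mul_re, ofReal_im, I_re, mul_zero, I_im, zero_mul, sub_self,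
    add_zero] at h1
  rw [norm_mul]
  calc _ ≤ (Real.exp (L * c) * (1 + Real.exp (L * c)) / L * (‖(c : ℂ) + v * I‖ ^ 2)⁻¹) *
        (K * (√(1 + ‖s‖) * √(1 + ‖(c : ℂ) + v * I‖))) := by
        gcongr
        exact (hK v).trans (by gcongr)
    _ = _ := by rw [div_eq_mul_inv (√_)]; ring

/-- Moving the line of integration across the double pole at `0`, where the residue is `F s`. -/
lemma integral_selbergKernel_mul_sub {L : ℝ} (hL : 0 < L) {F : ℂ → ℂ} {a c d : ℝ} (hc : 0 < c)
    (hd : 0 < d) {s : ℂ} (has : a < s.re - d) (hF : DifferentiableOn ℂ F {w | a < w.re}) {K : ℝ}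
    (hK0 : 0 ≤ K) (hK : ∀ w : ℂ, s.re - d ≤ w.re → ‖F w‖ ≤ K * √(1 + ‖w‖)) :
    (∫ v : ℝ, selbergKernel L (c + v * I) * F (s + (c + v * I))) - 2 * π * F s =
      ∫ v : ℝ, selbergKernel L ((-d : ℝ) + v * I) * F (s + ((-d : ℝ) + v * I)) := by
  set H : ℂ → ℂ := fun z => (cexp (2 * L * z) - cexp (L * z)) / L with hH
  set U : Set ℂ := {z | a - s.re < z.re} with hU
  have hUo : IsOpen U := isOpen_lt continuous_const continuous_re
  have hU0 : U ∈ 𝓝 (0 : ℂ) := hUo.mem_nhds (by simp only [hU, Set.mem_ofPred_eq, zero_re]; linarith)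
  have hFs : DifferentiableOn ℂ (fun z => F (s + z)) U := hF.comp (by fun_prop) fun z hz => by
    simp only [hU, Set.mem_ofPred_eq] at hz
    simp only [Set.mem_ofPred_eq, add_re]
    linarith
  have hHd : DifferentiableOn ℂ H U := by
    have : Differentiable ℂ H := by fun_prop
    exact this.differentiableOn
  set f : ℂ → ℂ := fun z => dslope H 0 z * dslope (fun z => F (s + z)) 0 z with hf
  have hfd : DifferentiableOn ℂ f U :=
    ((Complex.differentiableOn_dslope hU0).mpr hHd).mul
      ((Complex.differentiableOn_dslope hU0).mpr hFs)
  have hfz : ∀ z ≠ 0, f z = selbergKernel L z * (F (s + z) - F s) := fun z hz => by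
    simp only [hf]
    rw [dslope_of_ne _ hz, dslope_of_ne _ hz, slope_def_field, slope_def_field, hH]
    have hL' : (L : ℂ) ≠ 0 := by exact_mod_cast hL.ne'
    simp only [selbergKernel, mul_zero, Complex.exp_zero, sub_self, zero_div, sub_zero, add_zero]
    field_simp
  set M := Real.exp (L * c) * (1 + Real.exp (L * c)) / L with hM
  obtain ⟨K', hK0', hK'⟩ := exists_norm_sub_le_sqrt (s := s) hK
  have hshift := integral_vertical_eq (f := f) (a := a - s.re) (b := -d) (c := c) (s := 0)
    (K := M * K') (by linarith) (by linarith) hfd fun z hz1 hz2 hz3 => by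
      rw [sub_zero] at hz3 ⊢
      have hz0 : z ≠ 0 := norm_pos_iff.mp (by linarith)
      rw [hfz z hz0, norm_mul]
      have h1 := norm_selbergKernel_le hL z
      have h2 : Real.exp (L * z.re) * (1 + Real.exp (L * z.re)) / L ≤ M := by rw [hM]; gcongr
      have h3 := hK' z (by rw [add_re]; linarith)
      calc _ ≤ (M * (‖z‖ ^ 2)⁻¹) * (K' * √(1 + ‖z‖)) := by
            gcongr
            exact h1.trans (by gcongr)
        _ = _ := by rw [div_eq_mul_inv]; ring
  have hsplit : ∀ c : ℝ, c ≠ 0 → -d ≤ c →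
      ∫ v : ℝ, f (c + v * I) = (∫ v : ℝ, selbergKernel L (c + v * I) * F (s + (c + v * I))) -
        (∫ v : ℝ, selbergKernel L (c + v * I)) * F s := fun c hc hdc => by
    rw [← integral_mul_const, ← integral_sub _ ((integrable_selbergKernel L hc).mul_const _)]
    · refine integral_congr_ae (Eventually.of_forall fun v => ?_)
      simp only
      rw [hfz _ (vertical_ne_zero hc v)]
      ring
    · refine integrable_selbergKernel_mul hL hc (s := s) ?_ hK0 fun v => hK _ (by simp; linarith)
      exact hF.continuousOn.comp_continuous (by fun_prop) fun v => by simp; linarith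
  rw [hsplit c hc.ne' (by linarith), hsplit (-d) (by linarith) le_rfl,
    integral_selbergKernel hL hc, integral_selbergKernel_of_neg hL (by linarith)] at hshift
  push_cast at hshift ⊢
  linear_combination -hshift

/-- Poisson's formula for a half plane. -/
lemma integral_mul_inv_sq_add_sq {F : ℂ → ℂ} {a d : ℝ} (hd : 0 < d) {s : ℂ} (has : a < s.re - d)
    (hF : DifferentiableOn ℂ F {w | a < w.re}) {K : ℝ}
    (hK : ∀ w : ℂ, s.re - d ≤ w.re → ‖F w‖ ≤ K * √(1 + ‖w‖)) :
    (Integrable fun v : ℝ => F (s + ((-d : ℝ) + v * I)) * ((v ^ 2 + d ^ 2)⁻¹ : ℝ)) ∧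
    ∫ v : ℝ, F (s + ((-d : ℝ) + v * I)) * ((v ^ 2 + d ^ 2)⁻¹ : ℝ) = (π / d : ℝ) * F s := by
  obtain ⟨K', hK0, hK'⟩ := exists_norm_sub_le_sqrt (s := s) hK
  set U : Set ℂ := {z | max (a - s.re) (-(2 * d)) < z.re} with hU
  have hUd : max (a - s.re) (-(2 * d)) < -d := max_lt (by linarith) (by linarith)
  have hUo : IsOpen U := isOpen_lt continuous_const continuous_re
  have hU0 : U ∈ 𝓝 (0 : ℂ) := hUo.mem_nhds (by
    simp only [hU, Set.mem_ofPred_eq, zero_re]; linarith)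
  have hFs : DifferentiableOn ℂ (fun z => F (s + z)) U := hF.comp (by fun_prop) fun z hz => by
    have := (le_max_left _ _).trans_lt (show _ < z.re from hz)
    simp only [Set.mem_ofPred_eq, add_re]
    linarith
  have hne : ∀ z ∈ U, z + 2 * d ≠ 0 := fun z hz h => by
    have h1 := (le_max_right _ _).trans_lt (show _ < z.re from hz)
    have h2 := congrArg re h
    simp at h2
    linarith
  set f : ℂ → ℂ := fun z => dslope (fun z => F (s + z)) 0 z / (z + 2 * d) with hf
  have hfd : DifferentiableOn ℂ f U :=
    ((Complex.differentiableOn_dslope hU0).mpr hFs).div (by fun_prop) hne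
  have hfz : ∀ z ≠ 0, f z = (F (s + z) - F s) / (z * (z + 2 * d)) := fun z hz => by
    simp only [hf]
    rw [dslope_of_ne _ hz, slope_def_field, sub_zero, add_zero, div_div]
  have hbound : ∀ z : ℂ, -d ≤ z.re → 1 ≤ ‖z - 0‖ → ‖f z‖ ≤ K' * √(1 + ‖z‖) / ‖z - 0‖ ^ 2 := by
    intro z hz1 hz2
    rw [sub_zero] at hz2 ⊢
    have hz0 : z ≠ 0 := norm_pos_iff.mp (by linarith)
    have h1 : ‖z‖ ≤ ‖z + 2 * d‖ := by
      rw [← sq_le_sq₀ (norm_nonneg _) (norm_nonneg _), ← normSq_eq_norm_sq, ← normSq_eq_norm_sq,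
        normSq_apply, normSq_apply]
      simp
      nlinarith
    rw [hfz z hz0, norm_div, norm_mul, sq]
    gcongr
    exact hK' z (by rw [add_re]; linarith)
  have hline : ∀ v : ℝ, f ((-d : ℝ) + v * I) = F s * ((v ^ 2 + d ^ 2)⁻¹ : ℝ) -
      F (s + ((-d : ℝ) + v * I)) * ((v ^ 2 + d ^ 2)⁻¹ : ℝ) := fun v => by
    rw [hfz _ (vertical_ne_zero (by linarith) v)]
    have h1 : (((-d : ℝ) : ℂ) + v * I) * (((-d : ℝ) : ℂ) + v * I + 2 * d) =
        -((v ^ 2 + d ^ 2 : ℝ) : ℂ) := by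
      push_cast
      linear_combination (v : ℂ) ^ 2 * I_sq
    rw [h1, div_neg, div_eq_mul_inv, ofReal_inv]
    ring
  have hint0 := integral_vertical_eq_zero hUd hfd hbound
  obtain ⟨B, hB0, hB⟩ := exists_norm_le_rpow_of_norm_le_sqrt_div hUd hfd (s := 0)
    (S := {w | -d ≤ w.re}) (fun w hw => hw) hbound
  have hfi := integrable_vertical hUd hfd hB0 fun w hw => hB w hw.ge
  have hconst : Integrable fun v : ℝ => F s * ((v ^ 2 + d ^ 2)⁻¹ : ℝ) :=
    ((integrable_inv_sq_add_sq hd.ne').ofReal).const_mul _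
  have hFi : Integrable fun v : ℝ => F (s + ((-d : ℝ) + v * I)) * ((v ^ 2 + d ^ 2)⁻¹ : ℝ) := by
    refine (hconst.sub hfi).congr (Eventually.of_forall fun v => ?_)
    simp only [Pi.sub_apply]
    rw [hline]
    ring
  refine ⟨hFi, ?_⟩
  simp_rw [hline] at hint0
  rw [integral_sub hconst hFi, integral_const_mul, integral_complex_ofReal,
    integral_univ_inv_sq_add_sq hd] at hint0
  linear_combination -hint0

lemma integral_selbergKernel_mul_conj {L : ℝ} (hL : 0 < L) {F : ℂ → ℂ} {a d : ℝ} (hd : 0 < d)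
    {s : ℂ} (has : a < s.re - d) (hF : DifferentiableOn ℂ F {w | a < w.re}) {K : ℝ}
    (hK : ∀ w : ℂ, s.re - d ≤ w.re → ‖F w‖ ≤ K * √(1 + ‖w‖)) :
    ∫ v : ℝ, selbergKernel L ((-d : ℝ) + v * I) *
      (starRingEnd ℂ) (F (s + ((-d : ℝ) + v * I))) = 0 := by
  set r : ℂ := s - 2 * d with hr
  have hrre : r.re = s.re - 2 * d := by simp [hr]
  set f : ℂ → ℂ := fun z => selbergKernel L (-z) *
    (starRingEnd ℂ) (F (r + (starRingEnd ℂ) z)) with hf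
  set m : ℝ := max 0 (a - s.re + 2 * d) with hm
  have hmd : m < d := max_lt hd (by linarith)
  have hUo : IsOpen {z : ℂ | m < z.re} := isOpen_lt continuous_const continuous_re
  have hfd : DifferentiableOn ℂ f {z | m < z.re} := by
    refine ((differentiableOn_selbergKernel hL.ne').comp (by fun_prop) fun z hz => ?_).mul
      fun z hz => ?_
    · have h1 := (le_max_left _ _).trans_lt (show m < z.re from hz)
      refine neg_ne_zero.mpr fun h => ?_
      simp [h] at h1
    · have h1 := (le_max_right _ _).trans_lt (show m < z.re from hz)
      have h2 : DifferentiableAt ℂ F (r + (starRingEnd ℂ) z) :=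
        hF.differentiableAt ((isOpen_lt continuous_const continuous_re).mem_nhds (by
          simp only [Set.mem_ofPred_eq, add_re, conj_re, hrre]; linarith))
      have h3 : DifferentiableAt ℂ (fun u => F (r + u)) ((starRingEnd ℂ) z) :=
        h2.comp _ (by fun_prop)
      have h4 := h3.conj_conj
      rw [Complex.conj_conj] at h4
      exact h4.differentiableWithinAt
  have h := integral_vertical_eq_zero (s := 0) (K := 2 / L * (|K| * √(1 + ‖r‖))) hmd hfd
    fun z hz1 hz2 => by
      rw [sub_zero] at hz2 ⊢
      rw [hf]
      simp only [norm_mul, norm_conj]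
      have h1 := norm_selbergKernel_le hL (-z)
      rw [norm_neg, neg_re] at h1
      have h2 := hK (r + (starRingEnd ℂ) z) (by rw [add_re, conj_re, hrre]; linarith)
      have h3 := sqrt_one_add_norm_add_le r ((starRingEnd ℂ) z)
      rw [norm_conj] at h3
      have h4 : Real.exp (L * -z.re) ≤ 1 := Real.exp_le_one_iff.mpr (by nlinarith)
      have h5 := Real.exp_pos (L * -z.re)
      have h6 : Real.exp (L * -z.re) * (1 + Real.exp (L * -z.re)) ≤ 2 := by nlinarith
      calc _ ≤ (2 / L * (‖z‖ ^ 2)⁻¹) * (|K| * (√(1 + ‖r‖) * √(1 + ‖z‖))) := by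
            gcongr
            · exact h1.trans (by gcongr)
            · refine h2.trans ?_
              gcongr
              exact le_abs_self K
        _ = _ := by rw [div_eq_mul_inv _ (‖z‖ ^ 2)]; ring
  rw [← integral_neg_eq_self] at h
  rw [← h]
  refine integral_congr_ae (Eventually.of_forall fun v => ?_)
  simp only [hf]
  congr 2
  · push_cast; ring
  · congr 1
    simp only [hr, map_add, map_mul, conj_ofReal, conj_I]
    push_cast
    ring

lemma integrable_one_add_sq_rpow :
    Integrable fun v : ℝ => (1 + v ^ 2) ^ (-(3 / 4) : ℝ) := by
  have h := integrable_rpow_neg_one_add_norm_sq (E := ℝ) (μ := volume) (r := 3 / 2) (by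
    rw [Module.finrank_self]; norm_num)
  refine h.congr (Eventually.of_forall fun v => ?_)
  simp only [Real.norm_eq_abs, sq_abs]
  norm_num

lemma sq_add_sq_rpow_eq {d : ℝ} (hd : 0 < d) (v : ℝ) : (v ^ 2 + d ^ 2) ^ (-(3 / 4) : ℝ) =
    d ^ (-(3 / 2) : ℝ) * (1 + (v / d) ^ 2) ^ (-(3 / 4) : ℝ) := by
  have h : v ^ 2 + d ^ 2 = d ^ 2 * (1 + (v / d) ^ 2) := by field_simp; ring
  rw [h, Real.mul_rpow (by positivity) (by positivity), ← Real.rpow_natCast, ← Real.rpow_mul hd.le]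
  norm_num

lemma integrable_sq_add_sq_rpow {d : ℝ} (hd : 0 < d) :
    Integrable fun v : ℝ => (v ^ 2 + d ^ 2) ^ (-(3 / 4) : ℝ) := by
  simp_rw [sq_add_sq_rpow_eq hd]
  exact (integrable_one_add_sq_rpow.comp_div hd.ne').const_mul _

lemma integral_sq_add_sq_rpow {d : ℝ} (hd : 0 < d) :
    ∫ v : ℝ, (v ^ 2 + d ^ 2) ^ (-(3 / 4) : ℝ) = (∫ v : ℝ, (1 + v ^ 2) ^ (-(3 / 4) : ℝ)) / √d := by
  simp_rw [sq_add_sq_rpow_eq hd]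
  rw [integral_const_mul, Measure.integral_comp_div (fun v : ℝ => (1 + v ^ 2) ^ (-(3 / 4) : ℝ)),
    abs_of_pos hd, smul_eq_mul, ← mul_assoc, div_eq_mul_inv, mul_comm]
  congr 1
  rw [Real.sqrt_eq_rpow, ← Real.rpow_neg hd.le, ← Real.rpow_add_one hd.ne']
  norm_num

lemma sqrt_norm_mul_inv_sq_eq (c v : ℝ) :
    √‖(c : ℂ) + v * I‖ * (‖(c : ℂ) + v * I‖ ^ 2)⁻¹ = (v ^ 2 + c ^ 2) ^ (-(3 / 4) : ℝ) := by
  rw [← norm_add_mul_I_sq]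
  set r := ‖(c : ℂ) + v * I‖ with hr
  have hr0 : 0 ≤ r := norm_nonneg _
  rcases hr0.eq_or_lt with h | h
  · rw [← h]
    norm_num
  · rw [← Real.rpow_natCast, ← Real.rpow_neg hr0, ← Real.rpow_mul hr0, Real.sqrt_eq_rpow,
      ← Real.rpow_add h]
    norm_num

lemma norm_selbergKernel_vertical_le {L : ℝ} (hL : 0 < L) (c v : ℝ) :
    ‖selbergKernel L (c + v * I)‖ ≤
      Real.exp (L * c) * (1 + Real.exp (L * c)) / L * (v ^ 2 + c ^ 2)⁻¹ := by
  simpa [norm_add_mul_I_sq] using norm_selbergKernel_le hL (c + v * I)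

namespace DirichletCharacter

variable {q : ℕ} [NeZero q] {χ : DirichletCharacter ℂ q}

lemma integral_selbergKernel_mul_logDeriv_LFunction (hχ : χ.IsPrimitive) (hq : 1 < q)
    (h0 : ∀ s : ℂ, 1 / 2 < s.re → LFunction χ s ≠ 0) {x : ℝ} (hx : 1 < x) {d : ℝ} (hd : 0 < d)
    {s : ℂ} (hs : 1 / 2 < s.re - d) :
    -(2 * π * (logDeriv (LFunction χ) s + Dpoly χ x s)) =
      ∫ v : ℝ, selbergKernel (Real.log x) ((-d : ℝ) + v * I) *
        logDeriv (LFunction χ) (s + ((-d : ℝ) + v * I)) := by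
  have hL := Real.log_pos hx
  obtain ⟨K₁, hK₁0, hK₁⟩ := exists_norm_archimedeanLogDeriv_le χ
  obtain ⟨K₂, hK₂0, hK₂⟩ := hχ.exists_norm_xiLogDeriv_le hq h0 hs
  rw [← integral_selbergKernel_mul_sub hL (c := 2) two_pos hd hs
    (differentiableOn_logDeriv_LFunction (hχ.ne_one hq) h0) (add_nonneg hK₁0 hK₂0) fun w hw => by
      have h1 : logDeriv (LFunction χ) w = xiLogDeriv χ w - archimedeanLogDeriv χ w := by
        rw [xiLogDeriv, add_sub_cancel_right]
      rw [h1, add_mul, add_comm (K₁ * _)]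
      exact (norm_sub_le _ _).trans (add_le_add (hK₂ w hw) (hK₁ w (by linarith)))]
  have hlog : ∀ w : ℂ, 1 < w.re →
      logDeriv (LFunction χ) w = -LSeries (fun n => χ n * vonMangoldt n) w := fun w hw => by
    have h1 := LSeries_twist_vonMangoldt_eq χ hw
    rw [← LFunction_eq_LSeries χ hw, ← deriv_LFunction_eq_deriv_LSeries χ hw] at h1
    rw [logDeriv_apply, ← neg_eq_iff_eq_neg, ← neg_div]
    exact h1.symm
  have hint : ∀ v : ℝ, selbergKernel (Real.log x) ((2 : ℝ) + v * I) *
      logDeriv (LFunction χ) (s + ((2 : ℝ) + v * I)) =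
      -(selbergKernel (Real.log x) ((2 : ℝ) + v * I) *
        LSeries (fun n => χ n * vonMangoldt n) (s + ((2 : ℝ) + v * I))) := fun v => by
    rw [hlog _ (by simp; linarith), mul_neg]
  have hsum : LSeriesSummable (fun n => χ n * vonMangoldt n) (s + (2 : ℝ)) :=
    LSeriesSummable_twist_vonMangoldt χ (by simp; linarith)
  simp_rw [hint]
  rw [integral_neg, integral_selbergKernel_mul_LSeries _ two_pos hsum, tsum_term_mul_eq_Dpoly χ hx]
  ring

lemma IsPrimitive.norm_logDeriv_LFunction_add_Dpoly_le {C : ℝ} (hC : 0 < C)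
    (hP : ∀ s w : ℂ, 1 / 2 ≤ s.re → 1 / 2 ≤ w.re →
      ‖archimedeanLogDeriv χ s - archimedeanLogDeriv χ w‖ ≤ C * √‖s - w‖)
    (hχ : χ.IsPrimitive) (hq : 1 < q)
    (h0 : ∀ s : ℂ, 1 / 2 < s.re → LFunction χ s ≠ 0) {x : ℝ} (hx : 1 < x) {d e : ℝ} (hd : 0 < d)
    (he : 0 ≤ e) {s : ℂ} (hs : 1 / 2 < s.re - d) :
    ‖logDeriv (LFunction χ) (s + e) + Dpoly χ x (s + e)‖ ≤
      Real.exp (-(Real.log x * (e + d))) * (1 + Real.exp (-(Real.log x * (e + d)))) / Real.log x *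
        ((xiLogDeriv χ s).re / d +
          C * (∫ v : ℝ, (1 + v ^ 2) ^ (-(3 / 4) : ℝ)) / √(e + d)) := by
  have hL := Real.log_pos hx
  set L := Real.log x
  set M := Real.exp (-(L * (e + d))) * (1 + Real.exp (-(L * (e + d)))) / L with hM
  have hM0 : 0 ≤ M := by positivity
  have hed : 0 < e + d := by linarith
  have hsre : (s + e).re - (e + d) = s.re - d := by simp; ring
  have hse : 1 / 2 < (s + e).re - (e + d) := by rwa [hsre]
  obtain ⟨K₁, hK₁0, hK₁⟩ := exists_norm_archimedeanLogDeriv_le χ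
  obtain ⟨K₂, hK₂0, hK₂⟩ := hχ.exists_norm_xiLogDeriv_le hq h0 hs
  have hGd := differentiableOn_xiLogDeriv (hχ.ne_one hq) h0
  have hPd := differentiableOn_archimedeanLogDeriv χ
  set k : ℝ → ℂ := fun v => selbergKernel L ((-(e + d) : ℝ) + v * I) with hk
  set p : ℝ → ℂ := fun v => s + e + ((-(e + d) : ℝ) + v * I) with hp
  have hpre : ∀ v, (p v).re = s.re - d := fun v => by simp [hp]; ring
  have hpc : Continuous p := by fun_prop
  have hkn : ∀ v, ‖k v‖ ≤ M * (v ^ 2 + (e + d) ^ 2)⁻¹ := fun v => by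
    have := norm_selbergKernel_vertical_le hL (-(e + d)) v
    rwa [neg_sq, mul_neg] at this
  have hkG : Integrable fun v => k v * xiLogDeriv χ (p v) :=
    integrable_selbergKernel_mul hL (by linarith)
      (hGd.continuousOn.comp_continuous hpc fun v => by
        rw [Set.mem_ofPred_eq, hpre]; exact hs) hK₂0 (s := s + e) fun v => hK₂ _ (hpre v).ge
  have hkP : Integrable fun v => k v * archimedeanLogDeriv χ (p v) :=
    integrable_selbergKernel_mul hL (by linarith)
      (hPd.continuousOn.comp_continuous hpc fun v => by
        rw [Set.mem_ofPred_eq, hpre]; linarith) hK₁0 (s := s + e) fun v => hK₁ _ (by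
          rw [hpre]; linarith)
  have hkPs : Integrable fun v => k v * archimedeanLogDeriv χ (s + e) :=
    (integrable_selbergKernel L (by linarith)).mul_const _
  have hconj := integral_selbergKernel_mul_conj hL hed hse hGd fun w hw => hK₂ w (by linarith)
  have hkc : Integrable fun v => k v * (starRingEnd ℂ) (xiLogDeriv χ (p v)) :=
    integrable_selbergKernel_mul hL (by linarith)
      (continuous_conj.comp (hGd.continuousOn.comp_continuous hpc fun v => by
        rw [Set.mem_ofPred_eq, hpre]; exact hs)) hK₂0 (s := s + e) fun v => by
          rw [norm_conj]; exact hK₂ _ (hpre v).ge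
  have hmain : -(2 * π * (logDeriv (LFunction χ) (s + e) + Dpoly χ x (s + e))) =
      (∫ v, k v * (2 * (xiLogDeriv χ (p v)).re : ℝ)) -
        ∫ v, k v * (archimedeanLogDeriv χ (p v) - archimedeanLogDeriv χ (s + e)) := by
    rw [integral_selbergKernel_mul_logDeriv_LFunction hχ hq h0 hx hed hse]
    have h1 : ∀ v, k v * (2 * (xiLogDeriv χ (p v)).re : ℝ) = k v * xiLogDeriv χ (p v) +
        k v * (starRingEnd ℂ) (xiLogDeriv χ (p v)) := fun v => by
      rw [← mul_add, add_conj]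
    have h2 : ∀ v, k v * logDeriv (LFunction χ) (p v) =
        k v * xiLogDeriv χ (p v) - k v * archimedeanLogDeriv χ (p v) := fun v => by
      rw [xiLogDeriv]; ring
    have h3 : ∫ v, k v * archimedeanLogDeriv χ (s + e) = 0 := by
      rw [integral_mul_const, integral_selbergKernel_of_neg hL (by linarith), zero_mul]
    simp_rw [h1, mul_sub]
    rw [integral_add hkG hkc, integral_sub hkP hkPs, h3, hconj, integral_congr_ae
      (Eventually.of_forall h2), integral_sub hkG hkP]
    ring
  have hpoisson := integral_mul_inv_sq_add_sq hd hs hGd hK₂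
  have hpn : ∀ v : ℝ, s + ((-d : ℝ) + v * I) = p v := fun v => by
    simp only [hp]; push_cast; ring
  simp_rw [hpn] at hpoisson
  have hre : ∀ v : ℝ, (xiLogDeriv χ (p v) * ((v ^ 2 + d ^ 2)⁻¹ : ℝ)).re =
      (xiLogDeriv χ (p v)).re * (v ^ 2 + d ^ 2)⁻¹ := fun v => re_mul_ofReal _ _
  have hpi : Integrable fun v : ℝ => (xiLogDeriv χ (p v)).re * (v ^ 2 + d ^ 2)⁻¹ :=
    hpoisson.1.re.congr (Eventually.of_forall hre)
  have hpv : ∫ v : ℝ, (xiLogDeriv χ (p v)).re * (v ^ 2 + d ^ 2)⁻¹ =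
      π / d * (xiLogDeriv χ s).re := by
    have h1 := integral_re hpoisson.1
    rw [hpoisson.2] at h1
    rw [← re_ofReal_mul]
    refine Eq.trans (integral_congr_ae (Eventually.of_forall fun v => (hre v).symm)) h1
  have hb1 : ‖∫ v, k v * (2 * (xiLogDeriv χ (p v)).re : ℝ)‖ ≤
      2 * π * (M * ((xiLogDeriv χ s).re / d)) := by
    have h := norm_integral_le_of_norm_le (hpi.const_mul (2 * M))
      (f := fun v => k v * (2 * (xiLogDeriv χ (p v)).re : ℝ)) (Eventually.of_forall fun v => by
        have hnn : 0 ≤ (xiLogDeriv χ (p v)).re :=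
          hχ.re_logDeriv_LFunction_add_nonneg hq h0 (by rw [hpre]; exact hs)
        rw [norm_mul, norm_real, Real.norm_of_nonneg (by positivity)]
        calc _ ≤ (M * (v ^ 2 + (e + d) ^ 2)⁻¹) * (2 * (xiLogDeriv χ (p v)).re) := by
              gcongr
              exact hkn v
          _ ≤ (M * (v ^ 2 + d ^ 2)⁻¹) * (2 * (xiLogDeriv χ (p v)).re) := by
              gcongr
              linarith
          _ = _ := by ring)
    rw [integral_const_mul, hpv] at h
    refine h.trans (le_of_eq ?_)
    ring
  have hb2 : ‖∫ v, k v * (archimedeanLogDeriv χ (p v) - archimedeanLogDeriv χ (s + e))‖ ≤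
      2 * π * (M * (C * (∫ v : ℝ, (1 + v ^ 2) ^ (-(3 / 4) : ℝ)) / √(e + d))) := by
    have h := norm_integral_le_of_norm_le ((integrable_sq_add_sq_rpow hed).const_mul (M * C))
      (f := fun v => k v * (archimedeanLogDeriv χ (p v) - archimedeanLogDeriv χ (s + e)))
      (Eventually.of_forall fun v => by
        have h1 := hP (p v) (s + e) (by rw [hpre]; linarith) (by rw [add_re, ofReal_re]; linarith)
        rw [hp, add_sub_cancel_left] at h1
        have h2 := sqrt_norm_mul_inv_sq_eq (-(e + d)) v
        rw [norm_add_mul_I_sq, neg_sq] at h2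
        rw [norm_mul, ← h2]
        calc _ ≤ (M * (v ^ 2 + (e + d) ^ 2)⁻¹) * (C * √‖((-(e + d) : ℝ) : ℂ) + v * I‖) := by
              gcongr
              exact hkn v
          _ = _ := by ring)
    rw [integral_const_mul, integral_sq_add_sq_rpow hed] at h
    have hI : 0 ≤ ∫ v : ℝ, (1 + v ^ 2) ^ (-(3 / 4) : ℝ) :=
      integral_nonneg fun v => by positivity
    have hnn : 0 ≤ M * (C * (∫ v : ℝ, (1 + v ^ 2) ^ (-(3 / 4) : ℝ)) / √(e + d)) := by positivity
    calc _ ≤ _ := h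
      _ = 1 * (M * (C * (∫ v : ℝ, (1 + v ^ 2) ^ (-(3 / 4) : ℝ)) / √(e + d))) := by ring
      _ ≤ _ := by
        gcongr
        linarith [Real.pi_gt_three]
  have hfin := (norm_sub_le _ _).trans (add_le_add hb1 hb2)
  rw [← hmain, norm_neg, norm_mul, norm_mul, norm_real, Real.norm_of_nonneg pi_nonneg,
    RCLike.norm_ofNat, ← mul_add, ← mul_add] at hfin
  exact le_of_mul_le_mul_left hfin (by positivity)

end DirichletCharacter

lemma exists_norm_sub_mul_le {𝕜 : Type*} [RCLike 𝕜] {y : 𝕜} {A B : ℝ} (hA : 0 ≤ A) (hB : 0 ≤ B)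
    (hy : ‖y‖ ≤ A + B) : ∃ w : 𝕜, ‖w‖ ≤ 1 ∧ ‖y - A * w‖ ≤ B := by
  have hAB : 0 ≤ A + B := by positivity
  rcases hAB.eq_or_lt with h | h
  · refine ⟨0, by simp, ?_⟩
    rw [mul_zero, sub_zero]
    linarith
  · have hne : (A : 𝕜) + B ≠ 0 := by exact_mod_cast h.ne'
    have hw : ‖y / ((A : 𝕜) + B)‖ ≤ 1 := by
      rw [norm_div, ← RCLike.ofReal_add, RCLike.norm_of_nonneg hAB]
      exact div_le_one_of_le₀ hy hAB
    refine ⟨y / (A + B), hw, ?_⟩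
    have e : y - A * (y / (A + B)) = B * (y / (A + B)) := by
      field_simp
      ring
    rw [e, norm_mul, RCLike.norm_of_nonneg hB]
    exact mul_le_of_le_one_right hB hw

namespace DirichletCharacter

lemma exists_norm_logDeriv_LFunction_add_Dpoly_le : ∃ C : ℝ, 0 < C ∧
    ∀ (q : ℕ) [NeZero q] (χ : DirichletCharacter ℂ q), 1 < q → χ.IsPrimitive →
      (∀ s : ℂ, 1 / 2 < s.re → LFunction χ s ≠ 0) → ∀ x : ℝ, 4 ≤ x → ∀ s : ℂ,
        s.re = 1 / 2 + 1 / Real.log x → ∀ e : ℝ, 0 ≤ e →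
          ‖logDeriv (LFunction χ) (s + e) + Dpoly χ x (s + e)‖ ≤
            x ^ (1 / 2 - (s + e).re) * (1 + x ^ (1 / 2 - (s + e).re)) * (xiLogDeriv χ s).re +
              C * x ^ (1 / 2 - (s + e).re) := by
  obtain ⟨C, hC, hP⟩ := exists_norm_archimedeanLogDeriv_sub_le
  set J : ℝ := ∫ v : ℝ, (1 + v ^ 2) ^ (-(3 / 4) : ℝ)
  have hJ : 0 ≤ J := integral_nonneg fun v => by positivity
  refine ⟨2 * (C * J) + 1, by positivity, fun q _ χ hq hχ h0 x hx s hs e he => ?_⟩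
  have hL1 : 1 ≤ Real.log x := by
    rw [Real.le_log_iff_exp_le (by linarith)]
    linarith [Real.exp_one_lt_d9]
  set L := Real.log x with hL
  have hL0 : 0 < L := by linarith
  have hX : Real.exp (-(L * (e + 1 / L))) = x ^ (1 / 2 - (s + e).re) := by
    rw [Real.rpow_def_of_pos (by linarith), ← hL, add_re, hs, ofReal_re]
    congr 1
    ring
  have hXpos : 0 < x ^ (1 / 2 - (s + e).re) := by rw [← hX]; exact Real.exp_pos _
  have hX1 : x ^ (1 / 2 - (s + e).re) ≤ 1 := by
    rw [← hX, Real.exp_le_one_iff, neg_nonpos]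
    positivity
  have hlim : Tendsto (fun d : ℝ => Real.exp (-(L * (e + d))) * (1 + Real.exp (-(L * (e + d)))) / L *
      ((xiLogDeriv χ s).re / d + C * J / √(e + d))) (𝓝[<] (1 / L))
      (𝓝 (Real.exp (-(L * (e + 1 / L))) * (1 + Real.exp (-(L * (e + 1 / L)))) / L *
        ((xiLogDeriv χ s).re / (1 / L) + C * J / √(e + 1 / L)))) := by
    refine ContinuousAt.tendsto ?_ |>.mono_left nhdsWithin_le_nhds
    have h1 : (1 / L) ≠ 0 := by positivity
    have h2 : √(e + 1 / L) ≠ 0 := by positivity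
    fun_prop (disch := assumption)
  have hle := ge_of_tendsto hlim (by
    filter_upwards [Ioo_mem_nhdsLT (show 0 < 1 / L by positivity)] with d hd
    exact hχ.norm_logDeriv_LFunction_add_Dpoly_le hC (hP q χ) hq h0 (by linarith) hd.1 he (by
      rw [hs]; linarith [hd.2]))
  rw [hX] at hle
  set X := x ^ (1 / 2 - (s + e).re)
  have hsq : 1 ≤ L * √(e + 1 / L) := by
    rw [← Real.sqrt_sq hL0.le, ← Real.sqrt_mul (sq_nonneg L), Real.sqrt_sq hL0.le]
    refine Real.one_le_sqrt.mpr ?_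
    have h1 : L ^ 2 * (e + 1 / L) = L ^ 2 * e + L := by field_simp
    rw [h1]
    nlinarith [mul_nonneg (sq_nonneg L) he]
  have hsecond : X * (1 + X) / L * (C * J / √(e + 1 / L)) ≤ 2 * (C * J) * X := by
    rw [div_mul_div_comm]
    refine (div_le_self (by positivity) hsq).trans ?_
    have : 0 ≤ X * (C * J) := by positivity
    nlinarith
  have hfirst : X * (1 + X) / L * ((xiLogDeriv χ s).re / (1 / L)) =
      X * (1 + X) * (xiLogDeriv χ s).re := by
    field_simp
  rw [mul_add, hfirst] at hle
  linarith

end DirichletCharacter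

lemma LFunction_ne_zero_of_GRH {q : ℕ} [NeZero q] {χ : DirichletCharacter ℂ q} (hχ : χ ≠ 1)
    (h : GRH χ) (s : ℂ) (hs : 1 / 2 < s.re) : DirichletCharacter.LFunction χ s ≠ 0 := by
  intro h0
  rcases le_or_gt 1 s.re with h1 | h1
  · exact DirichletCharacter.LFunction_ne_zero_of_one_le_re χ (Or.inl hχ) h1 h0
  · linarith [h s h0 (by linarith) h1]

end

theorem logDeriv_L_explicit_formula :
    ∃ C : ℝ, 0 < C ∧
      ∀ (q : ℕ) [NeZero q] (χ : DirichletCharacter ℂ q), 1 < q → χ.IsPrimitive → GRH χ →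
        ∀ t : ℝ, 2 ≤ t → ∀ x : ℝ, 4 ≤ x → x ≤ t ^ 2 →
          ∃ w' : ℝ, -1 ≤ w' ∧ w' ≤ 1 ∧
            ∀ sg : ℝ, 1 / 2 + 1 / Real.log x ≤ sg →
              ∃ w : ℂ, ‖w‖ ≤ 1 ∧ ∃ E : ℂ, ‖E‖ ≤ C * x ^ (1 / 2 - sg) ∧
                logDeriv (DirichletCharacter.LFunction χ) (sg + t * Complex.I)
                  = -Dpoly χ x (sg + t * Complex.I)
                    - ((x ^ (1 / 2 - sg) * (1 + x ^ (1 / 2 - sg)) : ℝ) * w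
                        / ((1 - (1 / Real.exp 1) * (1 + 1 / Real.exp 1) * w' : ℝ) : ℂ))
                      * ((Dpoly χ x ((1 / 2 + 1 / Real.log x : ℝ) + t * Complex.I)).re : ℂ)
                    + ((x ^ (1 / 2 - sg) * (1 + x ^ (1 / 2 - sg)) : ℝ) * w
                        / ((1 - (1 / Real.exp 1) * (1 + 1 / Real.exp 1) * w' : ℝ) : ℂ))
                      * ((1 / 2) * Real.log (q * (t + 1)) : ℝ)
                    + E := by
  obtain ⟨C₁, hC₁, hmain⟩ := DirichletCharacter.exists_norm_logDeriv_LFunction_add_Dpoly_le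
  obtain ⟨C₂, hC₂, harch⟩ := DirichletCharacter.exists_abs_re_archimedeanLogDeriv_sub_log_le
  refine ⟨6 * (C₁ + C₂), by positivity, fun q _ χ hq hχ hGRH t ht x hx _ => ?_⟩
  have h0 := LFunction_ne_zero_of_GRH (hχ.ne_one hq) hGRH
  have hL1 : 1 ≤ Real.log x := by
    rw [Real.le_log_iff_exp_le (by linarith)]
    linarith [Real.exp_one_lt_d9]
  have hLinv : 1 / Real.log x ≤ 1 := div_le_one_of_le₀ hL1 (by linarith)
  have hLinv0 : 0 < 1 / Real.log x := by positivity
  set s₁ : ℂ := (1 / 2 + 1 / Real.log x : ℝ) + t * Complex.I with hs₁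
  have hre : s₁.re = 1 / 2 + 1 / Real.log x := by simp [hs₁]
  have him : s₁.im = t := by simp [hs₁]
  have hF0 := hχ.re_logDeriv_LFunction_add_nonneg hq h0 (w := s₁) (by rw [hre]; linarith)
  have hP := harch q χ s₁ (NeZero.ne q) (by rw [hre]; linarith) (by rw [hre]; linarith)
    (by rw [him]; exact ht)
  rw [him] at hP
  set F := (DirichletCharacter.xiLogDeriv χ s₁).re with hF
  change 0 ≤ F at hF0
  set N := 1 / 2 * Real.log (q * (t + 1))
  set D₁ := (Dpoly χ x s₁).re with hD₁
  set k := 1 / Real.exp 1 * (1 + 1 / Real.exp 1) with hk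
  have hk0 : 0 ≤ k := by positivity
  have hinv : 1 / Real.exp 1 ≤ 2 / 5 := by
    rw [div_le_div_iff₀ (by positivity) (by norm_num)]
    linarith [Real.exp_one_gt_d9]
  have hk1 : k ≤ 3 / 5 := by
    have : 0 ≤ 1 / Real.exp 1 := by positivity
    nlinarith
  obtain ⟨w', hw', hw'₁⟩ : ∃ w' : ℝ, ‖w'‖ ≤ 1 ∧
      ‖(logDeriv (DirichletCharacter.LFunction χ) s₁).re + D₁ - k * F * w'‖ ≤ C₁ := by
    refine exists_norm_sub_mul_le (𝕜 := ℝ) (A := k * F) (mul_nonneg hk0 hF0) hC₁.le ?_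
    have h := hmain q χ hq hχ h0 x hx s₁ hre 0 le_rfl
    have hX : x ^ (1 / 2 - s₁.re) = 1 / Real.exp 1 := by
      rw [hre, Real.rpow_def_of_pos (by linarith), one_div (Real.exp 1), ← Real.exp_neg]
      congr 1
      field_simp
      ring
    rw [ofReal_zero, add_zero, hX, ← hk, ← hF] at h
    rw [← add_re]
    refine (abs_re_le_norm _).trans (h.trans ?_)
    have : C₁ * (1 / Real.exp 1) ≤ C₁ := mul_le_of_le_one_right hC₁.le (by linarith)
    linarith
  rw [Real.norm_eq_abs, abs_le] at hw'
  refine ⟨w', hw'.1, hw'.2, fun sg hsg => ?_⟩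
  have hse : s₁ + (sg - (1 / 2 + 1 / Real.log x) : ℝ) = sg + t * Complex.I := by
    rw [hs₁]; push_cast; ring
  have hsgre : ((sg : ℂ) + t * Complex.I).re = sg := by simp
  have h := hmain q χ hq hχ h0 x hx s₁ hre (sg - (1 / 2 + 1 / Real.log x)) (by linarith)
  rw [hse, hsgre, ← hF] at h
  set s : ℂ := sg + t * Complex.I
  set X := x ^ (1 / 2 - sg)
  have hX0 : 0 < X := Real.rpow_pos_of_pos (by linarith) _
  have hX1 : X ≤ 1 := Real.rpow_le_one_of_one_le_of_nonpos (by linarith) (by linarith)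
  obtain ⟨w, hw, hwE⟩ := exists_norm_sub_mul_le (by positivity) (by positivity) h
  have hden : 2 / 5 ≤ 1 - k * w' := by nlinarith
  set m := 1 - k * w' with hm
  have hm0 : m ≠ 0 := by linarith
  have hdiff : |m * F - (N - D₁)| ≤ C₁ + C₂ := by
    have e : m * F - (N - D₁) =
        ((logDeriv (DirichletCharacter.LFunction χ) s₁).re + D₁ - k * F * w') +
          ((DirichletCharacter.archimedeanLogDeriv χ s₁).re - N) := by
      have : F = (logDeriv (DirichletCharacter.LFunction χ) s₁).re +
          (DirichletCharacter.archimedeanLogDeriv χ s₁).re := by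
        rw [hF, DirichletCharacter.xiLogDeriv, add_re]
      rw [hm]
      linear_combination this
    rw [e]
    exact (abs_add_le _ _).trans (add_le_add hw'₁ hP)
  have hm0' : (m : ℂ) ≠ 0 := by exact_mod_cast hm0
  refine ⟨w, hw, (logDeriv (DirichletCharacter.LFunction χ) s + Dpoly χ x s -
    ((X * (1 + X) * F : ℝ) : ℂ) * w) + (X * (1 + X) * ((m * F - (N - D₁)) / m) : ℝ) * w, ?_, ?_⟩
  · refine (norm_add_le _ _).trans ((add_le_add hwE ?_).trans (b := C₁ * X + 5 * (C₁ + C₂) * X) ?_)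
    · rw [norm_mul, norm_real, norm_mul, norm_div, norm_mul, Real.norm_eq_abs,
        Real.norm_eq_abs, Real.norm_eq_abs, Real.norm_eq_abs, abs_of_pos hX0,
        abs_of_pos (by linarith : 0 < 1 + X), abs_of_pos (by linarith : 0 < m)]
      calc _ ≤ X * (1 + 1) * ((C₁ + C₂) / (2 / 5)) * 1 := by gcongr
        _ = _ := by ring
    · nlinarith
  · push_cast
    field_simp
    ring
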